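/- arXiv:1811.08539 — 2 statements merged into one kernel-verified Lean document; each statement's English description precedes it below -/
import Mathlib

section
/- Let T ⊆ [3k] × 𝒞 be a partial schedule and γ, μ : 𝒞 → ℕ profiles with |T| + ‖γ‖ + ‖μ‖ ≤ k/2. Then Σ_{A ∈ ℱ(T,γ)} Σ_{B ∈ ℱ(T,μ)} Ẽ_T(A ∪ B) = (Σ_{A ∈ ℱ(T,γ)} Ẽ_T(A)) · (Σ_{B ∈ ℱ(T,μ)} Ẽ_T(B)), where Ẽ_T(A ∪ B) = 0 whenever A ∪ B is not a partial schedule. -/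
noncomputable section
open scoped Classical

/-- `S` is a partial schedule: every machine occurs in at most one pair of `S`. -/
def IsPartialSchedule {m : ℕ} {C : Type*} (S : Finset (Fin m × C)) : Prop :=
  ∀ p ∈ S, ∀ q ∈ S, p.1 = q.1 → p = q

/-- `δ_S(c)`: the number of machines that `S` connects to configuration `c`. -/
def deltaS {m : ℕ} {C : Type*} [DecidableEq C] (S : Finset (Fin m × C)) (c : C) : ℕ :=
  (S.filter fun e => e.2 = c).card

/-- The machine set `ℳ(S)` of `S`. -/
def machSet {m : ℕ} {C : Type*} (S : Finset (Fin m × C)) : Finset (Fin m) :=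
  S.image Prod.fst

/-- Falling factorial `(x)_b = x(x−1)⋯(x−b+1)`, with `(x)_0 = 1`. -/
def ffall : ℝ → ℕ → ℝ
  | _, 0 => 1
  | x, n + 1 => x * ffall (x - 1) n

/-- The conditional pseudoexpectation value
`Ẽ_T(S) = (1/(3k − |T|)_{|S|}) · ∏_{j=1}^{6} (k/2 − δ_T(C_j))_{δ_S(C_j)}`
if `S` is a partial schedule, and `0` otherwise. -/
def pexp (k : ℕ) (T S : Finset (Fin (3 * k) × Fin 6)) : ℝ :=
  if IsPartialSchedule S then
    (ffall ((3 * k : ℝ) - T.card) S.card)⁻¹ *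
      ∏ j : Fin 6, ffall ((k : ℝ) / 2 - deltaS T j) (deltaS S j)
  else 0

/-- A profile `γ : 𝒞 → ℕ` has norm `‖γ‖ = Σ_C γ(C)`. -/
def pnorm (γ : Fin 6 → ℕ) : ℕ := ∑ c : Fin 6, γ c

/-- `ℱ(T,γ)`: partial schedules `A` with `ℳ(A) ⊆ [m] ∖ ℳ(T)` in `γ`-profile. -/
def extFam (k : ℕ) (T : Finset (Fin (3 * k) × Fin 6)) (γ : Fin 6 → ℕ) :
    Finset (Finset (Fin (3 * k) × Fin 6)) :=
  Finset.univ.filter fun A =>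
    IsPartialSchedule A ∧ Disjoint (machSet A) (machSet T) ∧ ∀ c, deltaS A c = γ c

lemma ffall_succ (x : ℝ) (n : ℕ) : ffall x (n + 1) = ffall x n * (x - n) := by
  induction n generalizing x with
  | zero => simp [ffall]
  | succ n ih =>
    rw [ffall, ih (x - 1)]
    conv_rhs => rw [ffall]
    push_cast
    ring

lemma mem_machSet {m : ℕ} {S : Finset (Fin m × Fin 6)} {i : Fin m} :
    i ∈ machSet S ↔ ∃ d, (i, d) ∈ S := by
  simp [machSet]

lemma sched_mono {m : ℕ} {S S' : Finset (Fin m × Fin 6)} (h : S ⊆ S')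
    (hS : IsPartialSchedule S') : IsPartialSchedule S :=
  fun p hp q hq e => hS p (h hp) q (h hq) e

lemma sched_insert {m : ℕ} {S : Finset (Fin m × Fin 6)} {i : Fin m} {c : Fin 6}
    (hi : i ∉ machSet S) (hS : IsPartialSchedule S) :
    IsPartialSchedule (insert (i, c) S) := by
  rw [mem_machSet] at hi
  push Not at hi
  rintro ⟨p, p'⟩ hp ⟨q, q'⟩ hq e
  simp only [Finset.mem_insert, Prod.mk.injEq] at hp hq e ⊢
  subst e
  rcases hp with ⟨rfl, rfl⟩ | hp
  · rcases hq with ⟨_, rfl⟩ | hq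
    · simp
    · exact absurd hq (hi _)
  · rcases hq with ⟨rfl, rfl⟩ | hq
    · exact absurd hp (hi _)
    · simpa using hS _ hp _ hq rfl

lemma card_machSet {m : ℕ} {S : Finset (Fin m × Fin 6)} (hS : IsPartialSchedule S) :
    (machSet S).card = S.card := by
  apply Finset.card_image_of_injOn
  intro p hp q hq e
  exact hS p hp q hq e

lemma deltaS_insert {m : ℕ} {S : Finset (Fin m × Fin 6)} {i : Fin m} {c : Fin 6}
    (hi : (i, c) ∉ S) (d : Fin 6) :
    deltaS (insert (i, c) S) d = deltaS S d + if d = c then 1 else 0 := by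
  unfold deltaS
  rw [Finset.filter_insert]
  by_cases h : d = c
  · subst h
    simp [hi]
  · have : ¬ c = d := fun e => h e.symm
    simp [h, this]

lemma sum_deltaS {m : ℕ} (S : Finset (Fin m × Fin 6)) : ∑ c, deltaS S c = S.card := by
  unfold deltaS
  exact (Finset.card_eq_sum_card_fiberwise (fun x _ => Finset.mem_univ _)).symm

lemma pexp_insert (k : ℕ) (T S : Finset (Fin (3 * k) × Fin 6)) (i : Fin (3 * k)) (c : Fin 6)
    (hi : i ∉ machSet S) (hne : (3 * k : ℝ) - T.card - S.card ≠ 0) :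
    ((3 * k : ℝ) - T.card - S.card) * pexp k T (insert (i, c) S) =
      ((k : ℝ) / 2 - deltaS T c - deltaS S c) * pexp k T S := by
  have hic : (i, c) ∉ S := fun h => hi (mem_machSet.2 ⟨c, h⟩)
  unfold pexp
  by_cases hS : IsPartialSchedule S
  · rw [if_pos hS, if_pos (sched_insert hi hS), Finset.card_insert_of_notMem hic, ffall_succ]
    have hp : ∏ j : Fin 6, ffall ((k : ℝ) / 2 - deltaS T j) (deltaS (insert (i, c) S) j)
        = ((k : ℝ) / 2 - deltaS T c - deltaS S c) *
          ∏ j : Fin 6, ffall ((k : ℝ) / 2 - deltaS T j) (deltaS S j) := by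
      have : ∀ j, ffall ((k : ℝ) / 2 - deltaS T j) (deltaS (insert (i, c) S) j)
          = (if j = c then ((k : ℝ) / 2 - deltaS T c - deltaS S c) else 1) *
            ffall ((k : ℝ) / 2 - deltaS T j) (deltaS S j) := by
        intro j
        rw [deltaS_insert hic]
        by_cases h : j = c
        · subst h
          simp [ffall_succ, mul_comm]
        · simp [h]
      simp_rw [this]
      rw [Finset.prod_mul_distrib]
      simp
    rw [hp, mul_inv]
    field_simp
  · rw [if_neg hS, if_neg (fun h => hS (sched_mono (Finset.subset_insert _ _) h))]
    simp

lemma sum_free (k : ℕ) (T S : Finset (Fin (3 * k) × Fin 6)) (c : Fin 6)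
    (hT : IsPartialSchedule T) (hS : IsPartialSchedule S)
    (hd : Disjoint (machSet S) (machSet T)) (hlt : T.card + S.card < 3 * k) :
    ∑ i ∈ (machSet S ∪ machSet T)ᶜ, pexp k T (insert (i, c) S) =
      ((k : ℝ) / 2 - deltaS T c - deltaS S c) * pexp k T S := by
  have hlt' : (T.card : ℝ) + S.card < 3 * k := by exact_mod_cast hlt
  have hne : (3 * k : ℝ) - T.card - S.card ≠ 0 := by
    intro h
    linarith
  apply mul_left_cancel₀ hne
  rw [Finset.mul_sum]
  rw [Finset.sum_congr rfl (g := fun _ => ((k : ℝ) / 2 - deltaS T c - deltaS S c) * pexp k T S)]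
  · rw [Finset.sum_const, Finset.card_compl, Finset.card_union_of_disjoint hd, card_machSet hS,
      card_machSet hT, Fintype.card_fin, nsmul_eq_mul, Nat.cast_sub (by omega)]
    push_cast
    ring
  · intro i hi
    apply pexp_insert _ _ _ _ _ _ hne
    simp at hi
    tauto

lemma machSet_union {m : ℕ} (A B : Finset (Fin m × Fin 6)) :
    machSet (A ∪ B) = machSet A ∪ machSet B := Finset.image_union _ _

lemma sum_step (k : ℕ) (T A B : Finset (Fin (3 * k) × Fin 6)) (c : Fin 6)
    (hT : IsPartialSchedule T)
    (hdA : Disjoint (machSet A) (machSet T)) (hdB : Disjoint (machSet B) (machSet T))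
    (hlt : T.card + A.card + B.card < 3 * k) :
    ∑ i ∈ (machSet B ∪ machSet T)ᶜ, pexp k T (A ∪ insert (i, c) B) =
      ((k : ℝ) / 2 - deltaS T c - deltaS B c) * pexp k T (A ∪ B) := by
  simp_rw [Finset.union_insert]
  by_cases hS : IsPartialSchedule (A ∪ B)
  · have hsplit : (machSet B ∪ machSet T)ᶜ
        = (machSet (A ∪ B) ∪ machSet T)ᶜ ∪ (machSet A \ machSet B) := by
      ext i
      have : i ∈ machSet A → i ∉ machSet T := fun h => Finset.disjoint_left.1 hdA h
      simp only [machSet_union, Finset.mem_compl, Finset.mem_union, Finset.mem_sdiff]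
      tauto
    have hdisj : Disjoint (machSet (A ∪ B) ∪ machSet T)ᶜ (machSet A \ machSet B) := by
      rw [Finset.disjoint_left]
      intro i
      simp only [machSet_union, Finset.mem_compl, Finset.mem_union, Finset.mem_sdiff]
      tauto
    rw [hsplit, Finset.sum_union hdisj, sum_free k T (A ∪ B) c hT hS]
    · have h2 : ∑ i ∈ machSet A \ machSet B, pexp k T (insert (i, c) (A ∪ B))
          = ((deltaS (A ∪ B) c : ℝ) - deltaS B c) * pexp k T (A ∪ B) := by
        rw [Finset.sum_congr rfl
          (g := fun i => if (i, c) ∈ A then pexp k T (A ∪ B) else 0)]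
        · rw [← Finset.sum_filter, Finset.sum_const, nsmul_eq_mul]
          congr 1
          have hcard : ((machSet A \ machSet B).filter fun i => (i, c) ∈ A).card
              = (((A ∪ B).filter fun e => e.2 = c) \ (B.filter fun e => e.2 = c)).card := by
            apply Finset.card_bij (fun i _ => (i, c))
            · intro i hi
              simp only [Finset.mem_filter, Finset.mem_sdiff, mem_machSet] at hi
              simp only [Finset.mem_filter, Finset.mem_sdiff, Finset.mem_union]
              refine ⟨⟨Or.inl hi.2, trivial⟩, fun h => hi.1.2 ⟨c, h.1⟩⟩
            · intro i _ j _ h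
              simpa using h
            · rintro ⟨i, d⟩ h
              simp only [Finset.mem_filter, Finset.mem_sdiff, Finset.mem_union] at h
              obtain ⟨⟨h1, rfl⟩, h2⟩ := h
              have hA : (i, d) ∈ A := by tauto
              refine ⟨i, ?_, rfl⟩
              simp only [Finset.mem_filter, Finset.mem_sdiff, mem_machSet]
              refine ⟨⟨⟨d, hA⟩, ?_⟩, hA⟩
              rintro ⟨d', hB⟩
              have := hS (i, d) (Finset.mem_union_left _ hA) (i, d')
                (Finset.mem_union_right _ hB) rfl
              rw [this] at h2
              simp only [Prod.mk.injEq, true_and] at this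
              subst this
              exact h2 ⟨hB, rfl⟩
          rw [hcard]
          have hsub : (B.filter fun e => e.2 = c) ⊆ ((A ∪ B).filter fun e => e.2 = c) :=
            Finset.filter_subset_filter _ Finset.subset_union_right
          rw [Finset.card_sdiff_of_subset hsub, Nat.cast_sub (Finset.card_le_card hsub)]
          rfl
        · intro i hi
          simp only [Finset.mem_sdiff, mem_machSet] at hi
          obtain ⟨⟨d, hd⟩, _⟩ := hi
          split_ifs with h
          · rw [Finset.insert_eq_of_mem (Finset.mem_union_left _ h)]
          · unfold pexp
            rw [if_neg]
            intro hs
            have := hs (i, c) (Finset.mem_insert_self _ _) (i, d)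
              (Finset.mem_insert_of_mem (Finset.mem_union_left _ hd)) rfl
            rw [← this] at hd
            exact h hd
      rw [h2]
      ring
    · rw [machSet_union, Finset.disjoint_union_left]
      exact ⟨hdA, hdB⟩
    · have := Finset.card_union_le A B
      omega
  · have h0 : pexp k T (A ∪ B) = 0 := by
      unfold pexp
      rw [if_neg hS]
    rw [h0, mul_zero]
    apply Finset.sum_eq_zero
    intro i _
    unfold pexp
    rw [if_neg (fun h => hS (sched_mono (Finset.subset_insert _ _) h))]

lemma mem_extFam {k : ℕ} {T A : Finset (Fin (3 * k) × Fin 6)} {γ : Fin 6 → ℕ} :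
    A ∈ extFam k T γ ↔
      IsPartialSchedule A ∧ Disjoint (machSet A) (machSet T) ∧ ∀ c, deltaS A c = γ c := by
  simp [extFam]

lemma card_of_mem {k : ℕ} {T A : Finset (Fin (3 * k) × Fin 6)} {γ : Fin 6 → ℕ}
    (h : A ∈ extFam k T γ) : A.card = pnorm γ := by
  rw [← sum_deltaS, pnorm]
  exact Finset.sum_congr rfl fun c _ => (mem_extFam.1 h).2.2 c

lemma double_count (k : ℕ) (T : Finset (Fin (3 * k) × Fin 6)) (μ : Fin 6 → ℕ) (c : Fin 6)
    (f : Finset (Fin (3 * k) × Fin 6) → ℝ) :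
    ((μ c : ℝ) + 1) * ∑ B ∈ extFam k T (μ + Pi.single c 1), f B =
      ∑ B ∈ extFam k T μ, ∑ i ∈ (machSet B ∪ machSet T)ᶜ, f (insert (i, c) B) := by
  have h1 : ((μ c : ℝ) + 1) * ∑ B ∈ extFam k T (μ + Pi.single c 1), f B =
      ∑ B ∈ extFam k T (μ + Pi.single c 1), ∑ _e ∈ B.filter fun e => e.2 = c, f B := by
    rw [Finset.mul_sum]
    apply Finset.sum_congr rfl
    intro B hB
    have := (mem_extFam.1 hB).2.2 c
    unfold deltaS at this
    rw [Finset.sum_const, this]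
    simp
  rw [h1, Finset.sum_sigma', Finset.sum_sigma']
  refine Finset.sum_bij' (fun x _ => ⟨x.1.erase x.2, x.2.1⟩)
    (fun x _ => ⟨insert (x.2, c) x.1, (x.2, c)⟩) ?_ ?_ ?_ ?_ ?_
  · rintro ⟨B, i, d⟩ h
    simp only [Finset.mem_sigma, Finset.mem_filter, mem_extFam] at h
    obtain ⟨⟨hs, hd, hδ⟩, hm, rfl⟩ := h
    have hni : i ∉ machSet (B.erase (i, d)) := by
      rw [mem_machSet]
      rintro ⟨d', h'⟩
      rw [Finset.mem_erase] at h'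
      exact h'.1 (hs _ h'.2 _ hm rfl)
    have hsub : machSet (B.erase (i, d)) ⊆ machSet B :=
      Finset.image_subset_image (Finset.erase_subset _ _)
    simp only [Finset.mem_sigma, mem_extFam, Finset.mem_compl, Finset.mem_union]
    refine ⟨⟨sched_mono (Finset.erase_subset _ _) hs, Finset.disjoint_of_subset_left hsub hd, ?_⟩, ?_⟩
    · intro c
      have h2 := deltaS_insert (Finset.notMem_erase (i, d) B) c
      rw [Finset.insert_erase hm, hδ] at h2
      simp only [Pi.add_apply, Pi.single_apply] at h2
      omega
    · have := Finset.disjoint_left.1 hd (mem_machSet.2 ⟨d, hm⟩)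
      tauto
  · rintro ⟨B, i⟩ h
    simp only [Finset.mem_sigma, mem_extFam, Finset.mem_compl, Finset.mem_union] at h
    obtain ⟨⟨hs, hd, hδ⟩, hm⟩ := h
    push Not at hm
    have hic : (i, c) ∉ B := fun h => hm.1 (mem_machSet.2 ⟨c, h⟩)
    simp only [Finset.mem_sigma, Finset.mem_filter, mem_extFam]
    refine ⟨⟨sched_insert hm.1 hs, ?_, ?_⟩, Finset.mem_insert_self _ _, trivial⟩
    · unfold machSet at *
      rw [Finset.image_insert, Finset.disjoint_insert_left]
      exact ⟨hm.2, hd⟩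
    · intro d
      rw [deltaS_insert hic, hδ, Pi.add_apply, Pi.single_apply]
  · rintro ⟨B, i, d⟩ h
    simp only [Finset.mem_sigma, Finset.mem_filter, mem_extFam] at h
    obtain ⟨_, hm, rfl⟩ := h
    simp [Finset.insert_erase hm]
  · rintro ⟨B, i⟩ h
    simp only [Finset.mem_sigma, mem_extFam, Finset.mem_compl, Finset.mem_union] at h
    have hic : (i, c) ∉ B := fun h' => h.2 (Or.inl (mem_machSet.2 ⟨c, h'⟩))
    simp [Finset.erase_insert hic]
  · rintro ⟨B, i, d⟩ h
    simp only [Finset.mem_sigma, Finset.mem_filter, mem_extFam] at h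
    obtain ⟨_, hm, rfl⟩ := h
    simp [Finset.insert_erase hm]

lemma extFam_zero (k : ℕ) (T : Finset (Fin (3 * k) × Fin 6)) :
    extFam k T 0 = {∅} := by
  ext A
  rw [Finset.mem_singleton]
  constructor
  · intro h
    have := card_of_mem h
    rw [← Finset.card_eq_zero, this]
    simp [pnorm]
  · rintro rfl
    rw [mem_extFam]
    simp [IsPartialSchedule, machSet, deltaS]

lemma main_aux (k : ℕ) (T : Finset (Fin (3 * k) × Fin 6)) (hT : IsPartialSchedule T) (n : ℕ) :
    ∀ μ : Fin 6 → ℕ, pnorm μ = n → ∃ w : ℝ, ∀ A : Finset (Fin (3 * k) × Fin 6),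
      Disjoint (machSet A) (machSet T) → T.card + A.card + n ≤ 3 * k →
      ∑ B ∈ extFam k T μ, pexp k T (A ∪ B) = w * pexp k T A := by
  induction n with
  | zero =>
    intro μ hμ
    have : μ = 0 := by
      ext c
      unfold pnorm at hμ
      exact (Finset.sum_eq_zero_iff.1 hμ) c (Finset.mem_univ c)
    subst this
    refine ⟨1, fun A _ _ => ?_⟩
    simp [extFam_zero]
  | succ n ih =>
    intro μ hμ
    have : ∃ c, μ c ≠ 0 := by
      by_contra h
      push Not at h
      simp [pnorm, h] at hμ
    obtain ⟨c, hc⟩ := this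
    obtain ⟨ν, rfl⟩ : ∃ ν : Fin 6 → ℕ, μ = ν + Pi.single c 1 := by
      refine ⟨μ - Pi.single c 1, ?_⟩
      ext d
      simp only [Pi.add_apply, Pi.sub_apply, Pi.single_apply]
      split_ifs with h
      · subst h
        omega
      · omega
    have hν : pnorm ν = n := by
      unfold pnorm at hμ ⊢
      simp only [Pi.add_apply, Finset.sum_add_distrib] at hμ
      simp at hμ
      exact hμ
    obtain ⟨w, hw⟩ := ih ν hν
    have hpos : ((ν c : ℝ) + 1) ≠ 0 := by positivity
    refine ⟨((k : ℝ) / 2 - deltaS T c - ν c) * w / ((ν c : ℝ) + 1), fun A hA hcard => ?_⟩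
    have h1 := double_count k T ν c (fun B => pexp k T (A ∪ B))
    have h2 : ∑ B ∈ extFam k T ν, ∑ i ∈ (machSet B ∪ machSet T)ᶜ,
        pexp k T (A ∪ insert (i, c) B)
        = ((k : ℝ) / 2 - deltaS T c - ν c) * (w * pexp k T A) := by
      rw [← hw A hA (by omega), Finset.mul_sum]
      apply Finset.sum_congr rfl
      intro B hB
      have hB' := card_of_mem hB
      rw [sum_step k T A B c hT hA (mem_extFam.1 hB).2.1 (by omega),
        (mem_extFam.1 hB).2.2 c]
    rw [h2] at h1
    apply mul_left_cancel₀ hpos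
    rw [h1]
    field_simp

/-- Pseudoindependence: for a partial schedule `T` and profiles `γ, μ` with
`|T| + ‖γ‖ + ‖μ‖ ≤ k/2`,
`Σ_{A ∈ ℱ(T,γ)} Σ_{B ∈ ℱ(T,μ)} Ẽ_T(A ∪ B) = (Σ_{A} Ẽ_T(A)) · (Σ_{B} Ẽ_T(B))`
(where `Ẽ_T(A ∪ B) = 0` whenever `A ∪ B` is not a partial schedule). -/
theorem pexp_pseudoindependence (k : ℕ) (hk : Odd k) (hkpos : 0 < k)
    (T : Finset (Fin (3 * k) × Fin 6)) (hT : IsPartialSchedule T)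
    (γ μ : Fin 6 → ℕ)
    (hsize : (T.card : ℝ) + (pnorm γ : ℝ) + (pnorm μ : ℝ) ≤ (k : ℝ) / 2) :
    ∑ A ∈ extFam k T γ, ∑ B ∈ extFam k T μ, pexp k T (A ∪ B) =
      (∑ A ∈ extFam k T γ, pexp k T A) * (∑ B ∈ extFam k T μ, pexp k T B) := by
  have hle : T.card + pnorm γ + pnorm μ ≤ k := by
    have h0 : (0 : ℝ) ≤ k := Nat.cast_nonneg k
    have : (T.card : ℝ) + (pnorm γ : ℝ) + (pnorm μ : ℝ) ≤ (k : ℝ) := by linarith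
    exact_mod_cast this
  obtain ⟨w, hw⟩ := main_aux k T hT (pnorm μ) μ rfl
  have h0 : ∑ B ∈ extFam k T μ, pexp k T B = w := by
    have := hw ∅ (by simp [machSet]) (by simp; omega)
    have he : pexp k T ∅ = 1 := by
      simp [pexp, IsPartialSchedule, deltaS, ffall]
    simpa [he] using this
  rw [h0, Finset.sum_mul]
  apply Finset.sum_congr rfl
  intro A hA
  rw [hw A (mem_extFam.1 hA).2.1 (by rw [card_of_mem hA]; omega), mul_comm]
end
end

section
/- Let r be a natural number with r ≥ (2/ε²) · Σ_{q=0}^{s} (1/ε + 1)^q (a quantity of order 2^{Õ(1/ε²)}). If there exists a degree-r SA pseudoexpectation for the system assign(B,T), then there exists an integral solution of assign(B,(1+ε)T); in particular, there exists an assignment σ : J → [m] whose makespan max_{i∈[m]} Σ_{j:σ(j)=i} p_j is at most (1+ε)T. -/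
open MvPolynomial Finset

set_option synthInstance.maxHeartbeats 400000
noncomputable section
open scoped Classical

/-- The ideal `I_E` generated by `x_e^2 - x_e` for `e ∈ E`. -/
def cubeIdeal (E : Type*) : Ideal (MvPolynomial E ℝ) :=
  Ideal.span (Set.range fun e : E => (X e : MvPolynomial E ℝ) ^ 2 - X e)

/-- The quotient ring `ℝ[x]/I_E`. -/
abbrev CubeQuot (E : Type*) := MvPolynomial E ℝ ⧸ cubeIdeal E

def mkC {E : Type*} : MvPolynomial E ℝ →+* CubeQuot E :=
  Ideal.Quotient.mk (cubeIdeal E)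

/-- Degree of an element of `ℝ[x]/I_E` (degree of its square-free representative,
i.e. minimal total degree among representatives). -/
def qdeg {E : Type*} (a : CubeQuot E) : ℕ :=
  sInf (MvPolynomial.totalDegree '' {f : MvPolynomial E ℝ | mkC f = a})

/-- `φ_{S,R} = ∏_{e∈S} x_e · ∏_{e∈R} (1 − x_e)`. -/
def phiSR {E : Type*} (S R : Finset E) : MvPolynomial E ℝ :=
  (∏ e ∈ S, X e) * ∏ e ∈ R, (1 - X e)

/-- A degree-`r` Sherali–Adams pseudoexpectation for the system of linear constraints
`{g ≥ 0 (g ∈ G), h = 0 (h ∈ H)}` over 0/1 variables indexed by `E`. -/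
def IsSAPseudo {E : Type*} (G H : Set (MvPolynomial E ℝ)) (r : ℕ)
    (PE : CubeQuot E →ₗ[ℝ] ℝ) : Prop :=
  PE 1 = 1 ∧
  (∀ S R : Finset E, Disjoint S R → S.card + R.card ≤ r → 0 ≤ PE (mkC (phiSR S R))) ∧
  (∀ g ∈ G, ∀ S R : Finset E, Disjoint S R → qdeg (mkC (phiSR S R * g)) ≤ r →
    0 ≤ PE (mkC (phiSR S R * g))) ∧
  (∀ h ∈ H, ∀ S R : Finset E, Disjoint S R → qdeg (mkC (phiSR S R * h)) ≤ r →
    PE (mkC (phiSR S R * h)) = 0)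

/-- The class `J_q` of long jobs whose processing time lies in
`[(1/ε + q − 1)·ε²T, (1/ε + q)·ε²T)`. -/
def Jq {ι : Type*} [Fintype ι] (p : ι → ℝ) (ε T : ℝ) (q : ℕ) : Finset ι :=
  Finset.univ.filter fun j =>
    (1 / ε + (q : ℝ) - 1) * ε ^ 2 * T ≤ p j ∧ p j < (1 / ε + (q : ℝ)) * ε ^ 2 * T

/-- The equality constraints of `assign(B,T)`: `Σ_{i∈[m]} x_{ij} − 1 = 0` for each job `j`. -/
def assignEqs (m : ℕ) (ι : Type*) [Fintype ι] : Set (MvPolynomial (ℕ × ι) ℝ) :=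
  Set.range fun j : ι => (∑ i ∈ Finset.Icc 1 m, (X (i, j) : MvPolynomial (ℕ × ι) ℝ)) - 1

/-- The inequality constraints of `assign(B,T)`: load constraints, symmetry-breaking
constraints, and nonnegativity of the variables. -/
def assignIneqs {ι : Type*} [Fintype ι] (m s : ℕ) (p : ι → ℝ) (ε T : ℝ) (B : ℕ) :
    Set (MvPolynomial (ℕ × ι) ℝ) :=
  ((fun i : ℕ => MvPolynomial.C T - ∑ j : ι, MvPolynomial.C (p j) * X (i, j)) ''
      ↑(Finset.Icc 1 m)) ∪
  ((fun i : ℕ => ∑ q ∈ Finset.Icc 1 s,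
        MvPolynomial.C ((B : ℝ) ^ (s - q)) *
          ∑ j ∈ Jq p ε T q, ((X (i, j) : MvPolynomial (ℕ × ι) ℝ) - X (i + 1, j))) ''
      ↑(Finset.Icc 1 (m - 1))) ∪
  {f | ∃ i ∈ Finset.Icc 1 m, ∃ j : ι, f = X (i, j)}

structure SAD {ι : Type*} [Fintype ι] (m r k : ℕ) (p b : ι → ℝ) (T : ℝ)
    (E : Finset (ℕ × ι) → ℝ) : Prop where
  hT : 0 < T
  hp : ∀ j, 0 < p j
  hb : ∀ j, 0 ≤ b j
  hlong : ∀ j, 0 < b j → T ≤ k * p j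
  nonneg : ∀ A, A.card ≤ r → 0 ≤ E A
  anti1 : ∀ A e, A.card + 1 ≤ r → E (insert e A) ≤ E A
  eqn : ∀ A j, A.card + 1 ≤ r → ∑ i ∈ Icc 1 m, E (insert (i, j) A) = E A
  load : ∀ A, A.card + 1 ≤ r → ∀ i ∈ Icc 1 m, ∑ j, p j * E (insert (i, j) A) ≤ T * E A
  ord : ∀ A, A.card + 1 ≤ r → ∀ i ∈ Icc 1 (m - 1),
    ∑ j, b j * E (insert (i + 1, j) A) ≤ ∑ j, b j * E (insert (i, j) A)

def bjobs {ι : Type*} [Fintype ι] (b : ι → ℝ) (i : ℕ) (A : Finset (ℕ × ι)) : Finset ι :=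
  univ.filter fun j => 0 < b j ∧ (i, j) ∈ A

def bval {ι : Type*} [Fintype ι] (b : ι → ℝ) (i : ℕ) (A : Finset (ℕ × ι)) : ℝ :=
  ∑ j ∈ bjobs b i A, b j

def settled {ι : Type*} [Fintype ι] (b : ι → ℝ) (E : Finset (ℕ × ι) → ℝ)
    (i : ℕ) (A : Finset (ℕ × ι)) : Prop :=
  ∀ j, 0 < b j → (i, j) ∉ A → E (insert (i, j) A) = 0

def bV {ι : Type*} [Fintype ι] (b : ι → ℝ) (E : Finset (ℕ × ι) → ℝ)
    (i : ℕ) (A : Finset (ℕ × ι)) : ℝ :=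
  ∑ j, b j * E (insert (i, j) A)

namespace SAD

set_option linter.unusedSectionVars false
set_option linter.unusedVariables false
variable {ι : Type*} [Fintype ι] {m r k : ℕ} {p b : ι → ℝ} {T : ℝ} {E : Finset (ℕ × ι) → ℝ}

lemma anti (h : SAD m r k p b T E) {A A' : Finset (ℕ × ι)} (hs : A ⊆ A') (hc : A'.card ≤ r) :
    E A' ≤ E A := by
  have key : ∀ D : Finset (ℕ × ι), (A ∪ D).card ≤ r → E (A ∪ D) ≤ E A := by
    intro D
    induction D using Finset.induction_on with
    | empty => intro _; simp
    | insert e D he ih =>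
      intro hc
      rw [Finset.union_insert] at hc ⊢
      by_cases hm : e ∈ A ∪ D
      · rw [Finset.insert_eq_of_mem hm] at hc ⊢
        exact ih hc
      · rw [Finset.card_insert_of_notMem hm] at hc
        exact (h.anti1 _ e hc).trans (ih (by omega))
  have := key A' (by rwa [Finset.union_eq_right.2 hs])
  rwa [Finset.union_eq_right.2 hs] at this

lemma load_pos (h : SAD m r k p b T E) {A : Finset (ℕ × ι)} (hc : A.card + 1 ≤ r)
    (hA : 0 < E A) {i : ℕ} (hi : i ∈ Icc 1 m) (D : Finset ι) (hD : ∀ j ∈ D, (i, j) ∈ A) :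
    ∑ j ∈ D, p j ≤ T := by
  have h1 := h.load A hc i hi
  have h2 : (∑ j ∈ D, p j) * E A ≤ ∑ j, p j * E (insert (i, j) A) := by
    rw [Finset.sum_mul]
    calc _ = ∑ j ∈ D, p j * E (insert (i, j) A) := by
          refine Finset.sum_congr rfl fun j hj => ?_
          rw [Finset.insert_eq_of_mem (hD j hj)]
      _ ≤ _ := Finset.sum_le_sum_of_subset_of_nonneg (Finset.subset_univ _) fun j _ _ =>
          mul_nonneg (h.hp j).le (h.nonneg _ ((Finset.card_insert_le _ _).trans hc))
  exact le_of_mul_le_mul_right (h2.trans h1) hA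

lemma card_bjobs (h : SAD m r k p b T E) {A : Finset (ℕ × ι)} (hc : A.card + 1 ≤ r)
    (hA : 0 < E A) {i : ℕ} (hi : i ∈ Icc 1 m) : (bjobs b i A).card ≤ k := by
  have h1 := h.load_pos hc hA hi (bjobs b i A) (fun j hj => by simp [bjobs] at hj; exact hj.2)
  have h2 : (bjobs b i A).card * T ≤ k * ∑ j ∈ bjobs b i A, p j := by
    rw [Finset.mul_sum, ← nsmul_eq_mul, ← Finset.sum_const]
    refine Finset.sum_le_sum fun j hj => h.hlong j ?_
    simp [bjobs] at hj; exact hj.1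
  have h3 : ((bjobs b i A).card : ℝ) * T ≤ k * T :=
    h2.trans (mul_le_mul_of_nonneg_left h1 (Nat.cast_nonneg _))
  exact_mod_cast le_of_mul_le_mul_right h3 h.hT

lemma bjobs_mono {i : ℕ} {A A' : Finset (ℕ × ι)} (hs : A ⊆ A') :
    bjobs b i A ⊆ bjobs b i A' := by
  intro j hj
  simp only [bjobs, Finset.mem_filter, Finset.mem_univ, true_and] at hj ⊢
  exact ⟨hj.1, hs hj.2⟩

lemma bval_mono (h : SAD m r k p b T E) {i : ℕ} {A A' : Finset (ℕ × ι)} (hs : A ⊆ A') :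
    bval b i A ≤ bval b i A' :=
  Finset.sum_le_sum_of_subset_of_nonneg (bjobs_mono hs) fun j _ _ => h.hb j

lemma settled_bV (h : SAD m r k p b T E) {i : ℕ} {A : Finset (ℕ × ι)}
    (hS : settled b E i A) : bV b E i A = bval b i A * E A := by
  unfold bV bval
  rw [Finset.sum_mul]
  symm
  calc _ = ∑ j ∈ bjobs b i A, b j * E (insert (i, j) A) := by
        refine Finset.sum_congr rfl fun j hj => ?_
        simp [bjobs] at hj
        rw [Finset.insert_eq_of_mem hj.2]
    _ = _ := by
        refine Finset.sum_subset (Finset.subset_univ _) fun j _ hj => ?_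
        simp only [bjobs, Finset.mem_filter, Finset.mem_univ, true_and, not_and] at hj
        rcases (h.hb j).eq_or_lt with h0 | h0
        · rw [← h0, zero_mul]
        · rw [hS j h0 (hj h0), mul_zero]

lemma settled_ext (h : SAD m r k p b T E) {i : ℕ} {A A' : Finset (ℕ × ι)}
    (hS : settled b E i A) (hs : A ⊆ A') (hc : A'.card + 1 ≤ r) (hA : 0 < E A') :
    settled b E i A' ∧ bjobs b i A' = bjobs b i A := by
  have key : ∀ j, 0 < b j → (i, j) ∉ A → E (insert (i, j) A') = 0 := by
    intro j hj hn
    refine le_antisymm ?_ (h.nonneg _ ((Finset.card_insert_le _ _).trans hc))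
    rw [← hS j hj hn]
    exact h.anti (Finset.insert_subset_insert _ hs) ((Finset.card_insert_le _ _).trans hc)
  refine ⟨fun j hj hn => key j hj fun hm => hn (hs hm), ?_⟩
  refine (Finset.Subset.antisymm (bjobs_mono hs) fun j hj => ?_).symm
  simp only [bjobs, Finset.mem_filter, Finset.mem_univ, true_and] at hj ⊢
  refine ⟨hj.1, by_contra fun hn => ?_⟩
  have := key j hj.1 hn
  rw [Finset.insert_eq_of_mem hj.2] at this
  linarith

lemma settled_bval_ext (h : SAD m r k p b T E) {i : ℕ} {A A' : Finset (ℕ × ι)}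
    (hS : settled b E i A) (hs : A ⊆ A') (hc : A'.card + 1 ≤ r) (hA : 0 < E A') :
    bval b i A' = bval b i A := by
  unfold bval; rw [(h.settled_ext hS hs hc hA).2]

lemma bV_anti (h : SAD m r k p b T E) {A : Finset (ℕ × ι)} (hc : A.card + 1 ≤ r)
    {a : ℕ} (ha : 1 ≤ a) {i : ℕ} (hi : a ≤ i) (him : i ≤ m) : bV b E i A ≤ bV b E a A := by
  induction i, hi using Nat.le_induction with
  | base => exact le_rfl
  | succ n hn ih =>
    exact (h.ord A hc n (Finset.mem_Icc.2 ⟨by omega, by omega⟩)).trans (ih (by omega))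

/-- extend by the jobs `D` on machine `i` -/
lemma card_ext (A : Finset (ℕ × ι)) (i : ℕ) (D : Finset ι) :
    (A ∪ D.image (fun j => (i, j))).card ≤ A.card + D.card :=
  (Finset.card_union_le _ _).trans (Nat.add_le_add_left Finset.card_image_le _)

lemma exists_settled (h : SAD m r k p b T E) {A : Finset (ℕ × ι)} (hc : A.card + k + 2 ≤ r)
    {i : ℕ} (hi : i ∈ Icc 1 m) {D : Finset ι} (hDb : ∀ j ∈ D, 0 < b j)
    (hDk : D.card ≤ k)
    (hD : 0 < E (A ∪ D.image (fun j => (i, j)))) :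
    ∃ A', A ∪ D.image (fun j => (i, j)) ⊆ A' ∧ 0 < E A' ∧ A'.card ≤ A.card + k ∧
      settled b E i A' := by
  let P : Finset (Finset ι) := univ.filter fun D' => D ⊆ D' ∧ (∀ j ∈ D', 0 < b j) ∧ D'.card ≤ k ∧
    0 < E (A ∪ D'.image (fun j => (i, j)))
  have hP : P.Nonempty := ⟨D, by
    simp only [P, Finset.mem_filter, Finset.mem_univ, true_and]
    exact ⟨Finset.Subset.refl _, hDb, hDk, hD⟩⟩
  obtain ⟨D', hD', hmax⟩ := Finset.exists_max_image P Finset.card hP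
  simp only [P, Finset.mem_filter, Finset.mem_univ, true_and] at hD' hmax
  obtain ⟨h1, h2, h3, h4⟩ := hD'
  have hcD := card_ext A i D'
  refine ⟨A ∪ D'.image (fun j => (i, j)), ?_, h4, by omega, ?_⟩
  · exact Finset.union_subset_union_right (Finset.image_subset_image h1)
  · intro j hj hn
    by_contra hne
    have hcI := Finset.card_insert_le (i, j) (A ∪ D'.image (fun j => (i, j)))
    have hpos : 0 < E (insert (i, j) (A ∪ D'.image (fun j => (i, j)))) :=
      lt_of_le_of_ne (h.nonneg _ (by omega)) (Ne.symm hne)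
    have hjD : j ∉ D' := fun hm => hn (Finset.mem_union_right _ (Finset.mem_image_of_mem _ hm))
    have heq : insert (i, j) (A ∪ D'.image (fun j => (i, j)))
        = A ∪ (insert j D').image (fun j => (i, j)) := by
      rw [Finset.image_insert, Finset.union_insert]
    have hsub : insert j D' ⊆ bjobs b i (insert (i, j) (A ∪ D'.image (fun j => (i, j)))) := by
      intro x hx
      simp only [bjobs, Finset.mem_filter, Finset.mem_univ, true_and]
      rw [heq]
      refine ⟨?_, Finset.mem_union_right _ (Finset.mem_image_of_mem _ hx)⟩
      rcases Finset.mem_insert.1 hx with rfl | hx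
      · exact hj
      · exact h2 x hx
    have hk : (insert j D').card ≤ k :=
      (Finset.card_le_card hsub).trans (h.card_bjobs (by omega) hpos hi)
    have := hmax (insert j D') ⟨h1.trans (Finset.subset_insert _ _), by
      intro x hx
      rcases Finset.mem_insert.1 hx with rfl | hx
      · exact hj
      · exact h2 x hx, hk, by rwa [← heq]⟩
    rw [Finset.card_insert_of_notMem hjD] at this
    omega

def Q (h : SAD m r k p b T E) (Vals : Finset ℝ) (n : ℕ) : Prop :=
  ∃ (A : Finset (ℕ × ι)) (W : Finset ℝ), 0 < E A ∧ A.card ≤ 2 * k * W.card ∧ W ⊆ Vals ∧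
    (∀ i, 1 ≤ i → i ≤ n → ∃ a c, 1 ≤ a ∧ a ≤ i ∧ i ≤ c ∧ c ≤ m ∧ settled b E a A ∧
      settled b E c A ∧ bval b a A = bval b c A) ∧
    (∀ w ∈ W, ∀ i, n < i → i ≤ m → ∀ A', A ⊆ A' → 0 < E A' → A'.card + 1 ≤ r →
      bval b i A' < w)

lemma Q_step (h : SAD m r k p b T E) (Vals : Finset ℝ)
    (hV : ∀ A, 0 < E A → A.card + 1 ≤ r → ∀ i ∈ Icc 1 m, bval b i A ∈ Vals)
    (hr : 2 * k * Vals.card + 2 * k + 2 ≤ r) {n : ℕ} (hn : n < m) (hQ : h.Q Vals n) :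
    ∃ n', n < n' ∧ n' ≤ m ∧ h.Q Vals n' := by
  obtain ⟨A, W, hA, hAc, hW, hsand, hinv⟩ := hQ
  have hWc := Finset.card_le_card hW
  have hAc' : A.card ≤ 2 * k * Vals.card := hAc.trans (Nat.mul_le_mul_left _ hWc)
  have hi1 : n + 1 ∈ Icc 1 m := Finset.mem_Icc.2 ⟨by omega, by omega⟩
  obtain ⟨A1, hs1, hA1, hc1, hS1⟩ := h.exists_settled (A := A) (by omega) hi1 (D := ∅)
    (by simp) (by simp) (by simpa using hA)
  have hs1 : A ⊆ A1 := by simpa using hs1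
  set v := bval b (n + 1) A1 with hv
  have hvV : v ∈ Vals := hV A1 hA1 (by omega) _ hi1
  have hvW : v ∉ W := fun hm =>
    lt_irrefl _ (hinv v hm (n + 1) (by omega) (by omega) A1 hs1 hA1 (by omega))
  have hW' : insert v W ⊆ Vals := Finset.insert_subset hvV hW
  have hWc' := Finset.card_le_card hW'
  have hWcard : (insert v W).card = W.card + 1 := Finset.card_insert_of_notMem hvW
  have hAc2 : A.card + 2 * k ≤ 2 * k * (insert v W).card := by
    rw [hWcard, mul_add, mul_one]; omega
  have hAc3 : A.card + 2 * k ≤ 2 * k * Vals.card := hAc2.trans (Nat.mul_le_mul_left _ hWc')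
  let P : Finset ℕ := (Icc (n + 1) m).filter fun c => ∃ A', A1 ⊆ A' ∧ 0 < E A' ∧
    A'.card + 1 ≤ r ∧ v ≤ bval b c A'
  have hP : P.Nonempty := ⟨n + 1, by
    simp only [P, Finset.mem_filter, Finset.mem_Icc]
    exact ⟨⟨le_rfl, by omega⟩, A1, Finset.Subset.refl _, hA1, by omega, le_rfl⟩⟩
  obtain ⟨c, hc, hmax⟩ := Finset.exists_max_image P id hP
  simp only [P, Finset.mem_filter, Finset.mem_Icc, id] at hc hmax
  obtain ⟨⟨hc0, hcm⟩, A', hsA', hA', hcA', hvA'⟩ := hc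
  have hcI : c ∈ Icc 1 m := Finset.mem_Icc.2 ⟨by omega, hcm⟩
  have hsub : A1 ∪ (bjobs b c A').image (fun j => (c, j)) ⊆ A' := by
    refine Finset.union_subset hsA' fun x hx => ?_
    obtain ⟨j, hj, rfl⟩ := Finset.mem_image.1 hx
    simp only [bjobs, Finset.mem_filter] at hj
    exact hj.2.2
  obtain ⟨A2, hs2, hA2, hc2, hS2⟩ := h.exists_settled (A := A1) (by omega) hcI
    (D := bjobs b c A') (fun j hj => by simp only [bjobs, Finset.mem_filter] at hj; exact hj.2.1)
    (h.card_bjobs hcA' hA' hcI) (hA'.trans_le (h.anti hsub (by omega)))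
  have hs12 : A1 ⊆ A2 := Finset.subset_union_left.trans hs2
  have hr2 : A2.card + 1 ≤ r := by omega
  have hge : v ≤ bval b c A2 := by
    refine hvA'.trans (Finset.sum_le_sum_of_subset_of_nonneg ?_ fun j _ _ => h.hb j)
    intro j hj
    have hj' := hj
    simp only [bjobs, Finset.mem_filter, Finset.mem_univ, true_and] at hj ⊢
    exact ⟨hj.1, hs2 (Finset.mem_union_right _ (Finset.mem_image_of_mem _ hj'))⟩
  have hS1' := (h.settled_ext hS1 hs12 hr2 hA2).1
  have hv1 : bval b (n + 1) A2 = v := h.settled_bval_ext hS1 hs12 hr2 hA2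
  have heq : bval b c A2 = v := by
    refine le_antisymm ?_ hge
    have := h.bV_anti hr2 (a := n + 1) (by omega) hc0 hcm
    rw [h.settled_bV hS2, h.settled_bV hS1', hv1] at this
    exact le_of_mul_le_mul_right this hA2
  refine ⟨c, by omega, hcm, A2, insert v W, hA2, by omega, hW', ?_, ?_⟩
  · intro i hi hic
    rcases le_or_gt i n with hin | hin
    · obtain ⟨a, d, ha, hai, hid, hdm, hSa, hSd, hval⟩ := hsand i hi hin
      have hs := hs1.trans hs12
      refine ⟨a, d, ha, hai, hid, hdm, (h.settled_ext hSa hs hr2 hA2).1,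
        (h.settled_ext hSd hs hr2 hA2).1, ?_⟩
      rw [h.settled_bval_ext hSa hs hr2 hA2, h.settled_bval_ext hSd hs hr2 hA2, hval]
    · exact ⟨n + 1, c, by omega, hin, hic, hcm, hS1', hS2, by rw [hv1, heq]⟩
  · intro w hw i hi him A'' hs hpos hcard
    rcases Finset.mem_insert.1 hw with rfl | hw
    · by_contra hlt
      push Not at hlt
      have := hmax i ⟨⟨by omega, him⟩, A'', hs12.trans hs, hpos, hcard, hlt⟩
      omega
    · exact hinv w hw i (by omega) him A'' ((hs1.trans hs12).trans hs) hpos hcard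

lemma exists_sandwich (h : SAD m r k p b T E) (h1 : E ∅ = 1) (Vals : Finset ℝ)
    (hV : ∀ A, 0 < E A → A.card + 1 ≤ r → ∀ i ∈ Icc 1 m, bval b i A ∈ Vals)
    (hr : 2 * k * Vals.card + 2 * k + 2 ≤ r) :
    ∃ A : Finset (ℕ × ι), 0 < E A ∧ A.card ≤ 2 * k * Vals.card ∧
      ∀ i, 1 ≤ i → i ≤ m → ∃ a, 1 ≤ a ∧ a ≤ m ∧ ∀ A', A ⊆ A' → A'.card + 1 ≤ r →
        bV b E i A' = bval b a A * E A' := by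
  have hall : ∀ d, d ≤ m → ∃ n, d ≤ n ∧ n ≤ m ∧ h.Q Vals n := by
    intro d
    induction d with
    | zero =>
      intro _
      exact ⟨0, le_rfl, Nat.zero_le _, ∅, ∅, by rw [h1]; exact one_pos, by simp, by simp,
        fun i hi hi0 => by omega, by simp⟩
    | succ d ih =>
      intro hd
      obtain ⟨n, hn, hnm, hQ⟩ := ih (by omega)
      rcases lt_or_ge d n with hlt | hge
      · exact ⟨n, hlt, hnm, hQ⟩
      · obtain ⟨n', h1, h2, h3⟩ := h.Q_step Vals hV hr (by omega) hQ
        exact ⟨n', by omega, h2, h3⟩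
  obtain ⟨n, hn, hnm, A, W, hA, hAc, hW, hsand, -⟩ := hall m le_rfl
  have hmn : m = n := le_antisymm hn hnm
  subst hmn
  refine ⟨A, hA, hAc.trans (Nat.mul_le_mul_left _ (Finset.card_le_card hW)), ?_⟩
  intro i hi him
  obtain ⟨a, c, ha, hai, hic, hcm, hSa, hSc, hval⟩ := hsand i hi him
  refine ⟨a, ha, by omega, fun A' hs hc => ?_⟩
  rcases (h.nonneg A' (by omega)).eq_or_lt with h0 | hpos
  · rw [← h0, mul_zero]
    refine Finset.sum_eq_zero fun j _ => ?_
    have h2 := h.anti1 A' (i, j) hc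
    have h3 := h.nonneg (insert (i, j) A') ((Finset.card_insert_le _ _).trans hc)
    rw [le_antisymm (h2.trans h0.ge) h3, mul_zero]
  · have h2 := h.bV_anti hc ha hai him
    have h3 := h.bV_anti hc (a := i) (by omega) hic hcm
    rw [h.settled_bV (h.settled_ext hSa hs hc hpos).1, h.settled_bval_ext hSa hs hc hpos] at h2
    rw [h.settled_bV (h.settled_ext hSc hs hc hpos).1, h.settled_bval_ext hSc hs hc hpos,
      ← hval] at h3
    exact le_antisymm h2 h3

end SAD

lemma base_unique (B M : ℕ) (hB : 2 * M + 1 ≤ B) : ∀ (s : ℕ) (d : ℕ → ℤ),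
    (∀ q ∈ Icc 1 s, |d q| ≤ M) → ∑ q ∈ Icc 1 s, (B : ℤ) ^ (s - q) * d q = 0 →
    ∀ q ∈ Icc 1 s, d q = 0 := by
  intro s
  induction s with
  | zero => intro d _ _ q hq; simp at hq
  | succ s ih =>
    intro d hd hsum
    rw [Finset.sum_Icc_succ_top (by omega)] at hsum
    have h1 : ∑ q ∈ Icc 1 s, (B : ℤ) ^ (s + 1 - q) * d q
        = B * ∑ q ∈ Icc 1 s, (B : ℤ) ^ (s - q) * d q := by
      rw [Finset.mul_sum]
      refine Finset.sum_congr rfl fun q hq => ?_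
      have := (Finset.mem_Icc.1 hq).2
      rw [show s + 1 - q = (s - q) + 1 by omega, pow_succ]; ring
    rw [h1, Nat.sub_self, pow_zero, one_mul] at hsum
    have hlast : d (s + 1) = 0 := by
      refine Int.eq_zero_of_abs_lt_dvd (m := (B : ℤ)) ⟨-∑ q ∈ Icc 1 s, (B : ℤ) ^ (s - q) * d q, by linarith⟩ ?_
      have := hd (s + 1) (Finset.mem_Icc.2 ⟨by omega, le_rfl⟩)
      have : (2 * M + 1 : ℤ) ≤ B := by exact_mod_cast hB
      have : (0:ℤ) ≤ M := Int.natCast_nonneg _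
      linarith
    rw [hlast, add_zero] at hsum
    have hB0 : (B : ℤ) ≠ 0 := by
      have : B ≠ 0 := by omega
      exact_mod_cast this
    have h2 := (mul_eq_zero.1 hsum).resolve_left hB0
    have h3 := ih d (fun q hq => hd q (Finset.mem_Icc.2 ⟨(Finset.mem_Icc.1 hq).1,
      (Finset.mem_Icc.1 hq).2.trans (by omega)⟩)) h2
    intro q hq
    obtain ⟨hq1, hq2⟩ := Finset.mem_Icc.1 hq
    rcases Nat.lt_or_ge q (s + 1) with hlt | hge
    · exact h3 q (Finset.mem_Icc.2 ⟨hq1, by omega⟩)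
    · rw [show q = s + 1 by omega]; exact hlast

def clb {ι : Type*} [Fintype ι] (s B : ℕ) (cl : ℕ → Finset ι) (j : ι) : ℝ :=
  ∑ q ∈ Icc 1 s, if j ∈ cl q then (B : ℝ) ^ (s - q) else 0

namespace SAD

variable {ι : Type*} [Fintype ι] {m r k : ℕ} {p : ι → ℝ} {T : ℝ} {E : Finset (ℕ × ι) → ℝ}
  {s B M : ℕ} {cl : ℕ → Finset ι}

lemma clb_sum (D : Finset ι) (f : ι → ℝ) :
    ∑ j ∈ D, clb s B cl j * f j
      = ∑ q ∈ Icc 1 s, (B : ℝ) ^ (s - q) * ∑ j ∈ D.filter (· ∈ cl q), f j := by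
  unfold clb
  simp_rw [Finset.sum_mul]
  rw [Finset.sum_comm]
  refine Finset.sum_congr rfl fun q _ => ?_
  rw [Finset.mul_sum, Finset.sum_filter]
  refine Finset.sum_congr rfl fun j _ => ?_
  split_ifs <;> simp

lemma clb_pos (hB : 0 < B) {q : ℕ} (hq : q ∈ Icc 1 s) {j : ι} (hj : j ∈ cl q) :
    0 < clb s B cl j := by
  unfold clb
  have hB' : (0 : ℝ) < B := by exact_mod_cast hB
  refine Finset.sum_pos' (fun q _ => by split_ifs <;> positivity) ⟨q, hq, ?_⟩
  rw [if_pos hj]; positivity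

lemma bV_eq (i : ℕ) (A : Finset (ℕ × ι)) :
    bV (clb s B cl) E i A
      = ∑ q ∈ Icc 1 s, (B : ℝ) ^ (s - q) * ∑ j ∈ cl q, E (insert (i, j) A) := by
  unfold bV
  rw [clb_sum]
  simp

lemma bval_eq (i : ℕ) (A : Finset (ℕ × ι)) :
    bval (clb s B cl) i A
      = ∑ q ∈ Icc 1 s, (B : ℝ) ^ (s - q) * (((bjobs (clb s B cl) i A).filter (· ∈ cl q)).card : ℝ) := by
  unfold bval
  have := clb_sum (s := s) (B := B) (cl := cl) (bjobs (clb s B cl) i A) (fun _ => (1 : ℝ))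
  simpa using this

lemma class_counts (h : SAD m r k p (clb s B cl) T E) (hB : 2 * M + 1 ≤ B)
    (hM : ∀ q ∈ Icc 1 s, (cl q).card ≤ M) {A : Finset (ℕ × ι)} {i : ℕ} (hi : i ∈ Icc 1 m)
    (c : ℕ → ℕ) (hcM : ∀ q ∈ Icc 1 s, c q ≤ M)
    (hv : ∀ A', A ⊆ A' → A'.card + 1 ≤ r →
      bV (clb s B cl) E i A' = (∑ q ∈ Icc 1 s, (B : ℝ) ^ (s - q) * (c q : ℝ)) * E A') :
    ∀ (t : ℕ) (A' : Finset (ℕ × ι)), A ⊆ A' → A'.card + t + 1 ≤ r →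
      k < (bjobs (clb s B cl) i A').card + t →
      ∀ q ∈ Icc 1 s, ∑ j ∈ cl q, E (insert (i, j) A') = c q * E A' := by
  intro t
  induction t with
  | zero =>
    intro A' hs hc hk q hq
    have h0 : E A' = 0 := by
      rcases (h.nonneg A' (by omega)).eq_or_lt with h0 | hpos
      · exact h0.symm
      · have := h.card_bjobs (by omega) hpos hi
        omega
    rw [h0, mul_zero]
    refine Finset.sum_eq_zero fun j _ => ?_
    exact le_antisymm (h0 ▸ h.anti1 A' (i, j) (by omega))
      (h.nonneg _ ((Finset.card_insert_le _ _).trans (by omega)))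
  | succ t ih =>
    intro A' hs hc hk
    have hB0 : 0 < B := by omega
    have hBr : (0 : ℝ) < B := by exact_mod_cast hB0
    set U : ℕ → ℝ := fun q => ∑ j ∈ cl q, E (insert (i, j) A') with hU
    set u : ℕ → ℝ := fun q => U q - c q * E A' with hu
    set n : ℕ → ℕ := fun q => ((cl q).filter fun j => (i, j) ∈ A').card with hn
    have hX : ∀ q ∈ Icc 1 s, ∀ q' ∈ Icc 1 s,
        ∑ j ∈ cl q', ∑ j' ∈ cl q, E (insert (i, j') (insert (i, j) A'))
          = c q * U q' + n q' * u q := by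
      intro q hq q' hq'
      have : ∀ j ∈ cl q', ∑ j' ∈ cl q, E (insert (i, j') (insert (i, j) A'))
          = c q * E (insert (i, j) A') + (if (i, j) ∈ A' then 1 else 0) * u q := by
        intro j hj
        by_cases hm : (i, j) ∈ A'
        · rw [Finset.insert_eq_of_mem hm, if_pos hm]
          simp only [hu, hU]; ring
        · rw [if_neg hm, zero_mul, add_zero]
          refine ih (insert (i, j) A') (hs.trans (Finset.subset_insert _ _)) ?_ ?_ q hq
          · rw [Finset.card_insert_of_notMem hm]; omega
          · have hlt : (bjobs (clb s B cl) i A').card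
                < (bjobs (clb s B cl) i (insert (i, j) A')).card := by
              refine Finset.card_lt_card ((Finset.ssubset_iff_of_subset
                (bjobs_mono (Finset.subset_insert _ _))).2 ⟨j, ?_, ?_⟩)
              · simp only [bjobs, Finset.mem_filter, Finset.mem_univ, true_and]
                exact ⟨clb_pos hB0 hq' hj, Finset.mem_insert_self _ _⟩
              · simp only [bjobs, Finset.mem_filter, Finset.mem_univ, true_and]
                exact fun hh => hm hh.2
            omega
      rw [Finset.sum_congr rfl this, Finset.sum_add_distrib, ← Finset.mul_sum, ← Finset.sum_mul]
      simp [hn, hU]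
    have hsym : ∀ q ∈ Icc 1 s, ∀ q' ∈ Icc 1 s,
        ((c q : ℝ) - n q) * u q' = ((c q' : ℝ) - n q') * u q := by
      intro q hq q' hq'
      have e1 := hX q hq q' hq'
      have e2 := hX q' hq' q hq
      rw [Finset.sum_comm] at e2
      have e3 := e1.symm.trans ((Finset.sum_congr rfl fun j _ => Finset.sum_congr rfl fun j' _ => by
        rw [Finset.insert_comm]).trans e2)
      have hq1 : U q = u q + c q * E A' := by simp only [hu]; ring
      have hq2 : U q' = u q' + c q' * E A' := by simp only [hu]; ring
      rw [hq1, hq2] at e3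
      linear_combination e3
    have hsumu : ∑ q ∈ Icc 1 s, (B : ℝ) ^ (s - q) * u q = 0 := by
      have := hv A' hs (by omega)
      rw [bV_eq] at this
      simp only [hu, hU, mul_sub, Finset.sum_sub_distrib]
      rw [this, Finset.sum_mul, sub_eq_zero]
      exact Finset.sum_congr rfl fun q _ => by ring
    suffices hu0 : ∀ q ∈ Icc 1 s, u q = 0 by
      intro q hq
      have := hu0 q hq
      simp only [hu, hU] at this
      linarith
    by_cases hd : ∀ q ∈ Icc 1 s, (c q : ℤ) - n q = 0
    · have hnn : ∀ q ∈ Icc 1 s, 0 ≤ u q := by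
        intro q hq
        have hcn : (c q : ℝ) = n q := by exact_mod_cast sub_eq_zero.1 (hd q hq)
        simp only [hu, hU, hcn, hn]
        rw [sub_nonneg, ← nsmul_eq_mul, ← Finset.sum_const]
        calc _ = ∑ j ∈ (cl q).filter (fun j => (i, j) ∈ A'), E (insert (i, j) A') := by
              refine Finset.sum_congr rfl fun j hj => ?_
              rw [Finset.insert_eq_of_mem (Finset.mem_filter.1 hj).2]
          _ ≤ _ := Finset.sum_le_sum_of_subset_of_nonneg (Finset.filter_subset _ _) fun j _ _ =>
              h.nonneg _ ((Finset.card_insert_le _ _).trans (by omega))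
      intro q hq
      have := (Finset.sum_eq_zero_iff_of_nonneg fun q hq =>
        mul_nonneg (by positivity) (hnn q hq)).1 hsumu q hq
      exact (mul_eq_zero.1 this).resolve_left (by positivity)
    · have hD : (∑ q ∈ Icc 1 s, (B : ℤ) ^ (s - q) * ((c q : ℤ) - n q)) ≠ 0 := by
        intro h0
        refine hd (base_unique B M hB s _ ?_ h0)
        intro q hq
        have h1 : n q ≤ M := (Finset.card_filter_le _ _).trans (hM q hq)
        have h2 := hcM q hq
        rw [abs_le]; constructor <;> omega
      have hDr : (∑ q ∈ Icc 1 s, (B : ℝ) ^ (s - q) * ((c q : ℝ) - n q)) ≠ 0 := by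
        exact_mod_cast hD
      intro q hq
      have : (∑ q' ∈ Icc 1 s, (B : ℝ) ^ (s - q') * ((c q' : ℝ) - n q')) * u q = 0 := by
        rw [Finset.sum_mul]
        calc _ = ((c q : ℝ) - n q) * ∑ q' ∈ Icc 1 s, (B : ℝ) ^ (s - q') * u q' := by
              rw [Finset.mul_sum]
              refine Finset.sum_congr rfl fun q' hq' => ?_
              linear_combination -((B : ℝ) ^ (s - q')) * hsym q hq q' hq'
          _ = 0 := by rw [hsumu, mul_zero]
      exact (mul_eq_zero.1 this).resolve_left hDr

lemma exists_vals (h : SAD m r k p (clb s B cl) T E) :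
    ∃ Vals : Finset ℝ, Vals.card ≤ (k + 1) ^ s ∧
      ∀ A, 0 < E A → A.card + 1 ≤ r → ∀ i ∈ Icc 1 m, bval (clb s B cl) i A ∈ Vals := by
  refine ⟨(univ : Finset (↥(Icc 1 s) → Fin (k + 1))).image
    (fun f => ∑ q : ↥(Icc 1 s), (B : ℝ) ^ (s - q.1) * ((f q : ℕ) : ℝ)), ?_, ?_⟩
  · refine Finset.card_image_le.trans ?_
    simp
  · intro A hA hc i hi
    have hk := h.card_bjobs hc hA hi
    refine Finset.mem_image.2 ⟨fun q =>
      ⟨((bjobs (clb s B cl) i A).filter (· ∈ cl q.1)).card,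
        Nat.lt_succ_of_le ((Finset.card_filter_le _ _).trans hk)⟩, Finset.mem_univ _, ?_⟩
    rw [bval_eq]
    exact Finset.sum_coe_sort (Icc 1 s) (fun q => (B : ℝ) ^ (s - q) *
      (((bjobs (clb s B cl) i A).filter (· ∈ cl q)).card : ℝ))

theorem exists_configs (h : SAD m r k p (clb s B cl) T E) (h1 : E ∅ = 1)
    (hB : 2 * M + 1 ≤ B) (hM : ∀ q ∈ Icc 1 s, (cl q).card ≤ M)
    (hr : 2 * k * (k + 1) ^ s + 2 * k + 3 ≤ r)
    (TJ : Finset ι) (hTJ : ∀ j ∈ TJ, p j = T ∧ clb s B cl j = 0) :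
    ∃ D : ℕ → Finset ι, (∀ i ∈ Icc 1 m, (D i).card ≤ k ∧ ∑ j ∈ D i, p j ≤ T) ∧
      (∀ q ∈ Icc 1 s, ∑ i ∈ Icc 1 m, ((D i).filter (· ∈ cl q)).card = (cl q).card) ∧
      ∃ Z : Finset ℕ, Z ⊆ Icc 1 m ∧ (∀ i ∈ Z, ∀ q ∈ Icc 1 s,
        ((D i).filter (· ∈ cl q)).card = 0) ∧ Z.card = TJ.card := by
  obtain ⟨Vals, hVc, hV⟩ := h.exists_vals
  have hVc' : 2 * k * Vals.card ≤ 2 * k * (k + 1) ^ s := Nat.mul_le_mul_left _ hVc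
  obtain ⟨A, hA, hAc, hsand⟩ := h.exists_sandwich h1 Vals hV (by omega)
  have hsand' : ∀ i, ∃ a, i ∈ Icc 1 m → a ∈ Icc 1 m ∧ ∀ A', A ⊆ A' → A'.card + 1 ≤ r →
        bV (clb s B cl) E i A' = bval (clb s B cl) a A * E A' := by
    intro i
    by_cases hi : i ∈ Icc 1 m
    · obtain ⟨a, ha, ham, hh⟩ := hsand i (Finset.mem_Icc.1 hi).1 (Finset.mem_Icc.1 hi).2
      exact ⟨a, fun _ => ⟨Finset.mem_Icc.2 ⟨ha, ham⟩, hh⟩⟩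
    · exact ⟨0, fun hh => absurd hh hi⟩
  choose a ha using hsand'
  have hB0 : 0 < B := by omega
  have hBr : (0 : ℝ) < B := by exact_mod_cast hB0
  set D : ℕ → Finset ι := fun i => bjobs (clb s B cl) (a i) A with hD
  set c : ℕ → ℕ → ℕ := fun i q => ((D i).filter (· ∈ cl q)).card with hcdef
  have hcount : ∀ i ∈ Icc 1 m, ∀ q ∈ Icc 1 s,
      ∑ j ∈ cl q, E (insert (i, j) A) = c i q * E A := by
    intro i hi
    refine h.class_counts hB hM hi (c i) ?_ ?_ (k + 1) A (Finset.Subset.refl _) (by omega) (by omega)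
    · intro q hq
      refine le_trans (Finset.card_le_card ?_) (hM q hq)
      intro j hj
      exact (Finset.mem_filter.1 hj).2
    · intro A' hs hc
      rw [(ha i hi).2 A' hs hc, bval_eq]
  refine ⟨D, ?_, ?_, ?_⟩
  · intro i hi
    exact ⟨h.card_bjobs (by omega) hA (ha i hi).1,
      h.load_pos (by omega) hA (ha i hi).1 _ fun j hj => by
        simp only [hD, bjobs, Finset.mem_filter] at hj; exact hj.2.2⟩
  · intro q hq
    have e : (∑ i ∈ Icc 1 m, (c i q : ℝ)) * E A = (cl q).card * E A := by
      rw [Finset.sum_mul, ← Finset.sum_congr rfl (fun i hi => hcount i hi q hq), Finset.sum_comm,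
        Finset.sum_congr rfl (fun j _ => h.eqn A j (by omega))]
      simp
    have := mul_right_cancel₀ hA.ne' e
    exact_mod_cast this
  · obtain ⟨Z, hZ⟩ : ∃ Z : Finset ℕ, ∀ i, i ∈ Z ↔ i ∈ Icc 1 m ∧ ∀ q ∈ Icc 1 s, c i q = 0 :=
      ⟨(Icc 1 m).filter fun i => ∀ q ∈ Icc 1 s, c i q = 0, fun i => by simp⟩
    have hnz : ∀ i ∈ Icc 1 m, i ∉ Z → ∀ j ∈ TJ, E (insert (i, j) A) = 0 := by
      intro i hi hiZ j hj
      have hex : ∃ q ∈ Icc 1 s, c i q ≠ 0 := by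
        by_contra hno
        push Not at hno
        exact hiZ ((hZ i).2 ⟨hi, hno⟩)
      obtain ⟨q, hq, hcq⟩ := hex
      have hcI := Finset.card_insert_le (i, j) A
      set A' := insert (i, j) A with hA'
      have hEA' : 0 ≤ E A' := h.nonneg _ (by omega)
      have hnn : ∀ j', 0 ≤ E (insert (i, j') A') := fun j' =>
        h.nonneg _ ((Finset.card_insert_le _ _).trans (by omega))
      have hl := h.load A' (by omega) i hi
      rw [← Finset.add_sum_erase _ _ (Finset.mem_univ j),
        Finset.insert_eq_of_mem (Finset.mem_insert_self _ _), (hTJ j hj).1] at hl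
      have hl0 : ∑ j' ∈ univ.erase j, p j' * E (insert (i, j') A') = 0 :=
        le_antisymm (by linarith) (Finset.sum_nonneg fun j' _ => mul_nonneg (h.hp j').le (hnn j'))
      rw [Finset.sum_eq_zero_iff_of_nonneg
        (fun j' _ => mul_nonneg (h.hp j').le (hnn j'))] at hl0
      have hV0 : bV (clb s B cl) E i A' = 0 := by
        refine Finset.sum_eq_zero fun j' _ => ?_
        by_cases hjj : j' = j
        · rw [hjj, (hTJ j hj).2, zero_mul]
        · rw [(mul_eq_zero.1 (hl0 j' (Finset.mem_erase.2 ⟨hjj, Finset.mem_univ _⟩))).resolve_left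
            (h.hp j').ne', mul_zero]
      rw [(ha i hi).2 A' (Finset.subset_insert _ _) (by omega)] at hV0
      refine (mul_eq_zero.1 hV0).resolve_left (ne_of_gt ?_)
      rw [bval_eq]
      refine Finset.sum_pos' (fun q _ => by positivity) ⟨q, hq, ?_⟩
      have : (0 : ℝ) < (c i q : ℝ) := by exact_mod_cast Nat.pos_of_ne_zero hcq
      exact mul_pos (by positivity) this
    have hz : ∀ i ∈ Icc 1 m, ∑ j ∈ TJ, E (insert (i, j) A) ≤ E A := by
      intro i hi
      have hl := h.load A (by omega) i hi
      have : T * ∑ j ∈ TJ, E (insert (i, j) A) ≤ ∑ j, p j * E (insert (i, j) A) := by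
        rw [Finset.mul_sum]
        calc _ = ∑ j ∈ TJ, p j * E (insert (i, j) A) :=
              Finset.sum_congr rfl fun j hj => by rw [(hTJ j hj).1]
          _ ≤ _ := Finset.sum_le_sum_of_subset_of_nonneg (Finset.subset_univ _) fun j _ _ =>
              mul_nonneg (h.hp j).le (h.nonneg _ ((Finset.card_insert_le _ _).trans (by omega)))
      exact le_of_mul_le_mul_left (this.trans hl) h.hT
    have e : (TJ.card : ℝ) * E A ≤ Z.card * E A := by
      calc (TJ.card : ℝ) * E A = ∑ j ∈ TJ, ∑ i ∈ Icc 1 m, E (insert (i, j) A) := by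
            rw [Finset.sum_congr rfl (fun j _ => h.eqn A j (by omega))]; simp
        _ = ∑ i ∈ Icc 1 m, ∑ j ∈ TJ, E (insert (i, j) A) := Finset.sum_comm
        _ = ∑ i ∈ Z, ∑ j ∈ TJ, E (insert (i, j) A) := by
            symm
            refine Finset.sum_subset (fun i hi => ((hZ i).1 hi).1) fun i hi hiZ => ?_
            exact Finset.sum_eq_zero (hnz i hi hiZ)
        _ ≤ ∑ i ∈ Z, E A := Finset.sum_le_sum fun i hi => hz i ((hZ i).1 hi).1
        _ = _ := by simp
    have hle : TJ.card ≤ Z.card := by exact_mod_cast le_of_mul_le_mul_right e hA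
    obtain ⟨Z', hZ', hcard⟩ := Finset.exists_subset_card_eq hle
    exact ⟨Z', fun i hi => ((hZ i).1 (hZ' hi)).1, fun i hi => ((hZ i).1 (hZ' hi)).2, hcard⟩

end SAD

lemma fiber_assign {ι : Type*} (I : Finset ℕ) (c : ℕ → ℕ) : ∀ (S : Finset ι),
    ∑ i ∈ I, c i = S.card →
    ∃ σ : ι → ℕ, (∀ j ∈ S, σ j ∈ I) ∧ ∀ i ∈ I, (S.filter fun j => σ j = i).card = c i := by
  induction I using Finset.induction_on with
  | empty =>
    intro S hS
    have : S = ∅ := by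
      rw [Finset.sum_empty] at hS
      exact Finset.card_eq_zero.1 hS.symm
    subst this
    exact ⟨fun _ => 0, by simp, by simp⟩
  | insert a I ha ih =>
    intro S hS
    rw [Finset.sum_insert ha] at hS
    obtain ⟨S', hS', hcard⟩ := Finset.exists_subset_card_eq (show c a ≤ S.card by omega)
    obtain ⟨σ, h1, h2⟩ := ih (S \ S') (by rw [Finset.card_sdiff_of_subset hS']; omega)
    refine ⟨fun j => if j ∈ S' then a else σ j, ?_, ?_⟩
    · intro j hj
      by_cases hm : j ∈ S'
      · simp [hm]
      · simp only [hm, if_false]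
        exact Finset.mem_insert_of_mem (h1 j (Finset.mem_sdiff.2 ⟨hj, hm⟩))
    · intro i hi
      rcases Finset.mem_insert.1 hi with rfl | hi
      · rw [← hcard]
        congr 1
        ext j
        simp only [Finset.mem_filter]
        constructor
        · rintro ⟨hj, he⟩
          by_contra hm
          rw [if_neg hm] at he
          exact ha (he ▸ h1 j (Finset.mem_sdiff.2 ⟨hj, hm⟩))
        · intro hm
          exact ⟨hS' hm, if_pos hm⟩
      · rw [← h2 i hi]
        congr 1
        ext j
        simp only [Finset.mem_filter, Finset.mem_sdiff]
        constructor
        · rintro ⟨hj, he⟩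
          by_cases hm : j ∈ S'
          · rw [if_pos hm] at he
            exact absurd (he ▸ hi) ha
          · rw [if_neg hm] at he
            exact ⟨⟨hj, hm⟩, he⟩
        · rintro ⟨⟨hj, hm⟩, he⟩
          exact ⟨hj, by rw [if_neg hm]; exact he⟩

lemma greedy {ι : Type*} (m : ℕ) (p : ι → ℝ) (hp : ∀ j, 0 < p j) (T Tε : ℝ)
    (L : Finset ι) (σ₀ : ι → ℕ) (h₀ : ∀ j ∈ L, σ₀ j ∈ Icc 1 m)
    (hL : ∀ i ∈ Icc 1 m, ∑ j ∈ L.filter (fun j => σ₀ j = i), p j ≤ T + Tε) :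
    ∀ S : Finset ι, Disjoint L S → (∀ j ∈ S, p j ≤ Tε) → ∑ j ∈ L ∪ S, p j ≤ m * T →
    ∃ σ : ι → ℕ, (∀ j ∈ L ∪ S, σ j ∈ Icc 1 m) ∧
      ∀ i ∈ Icc 1 m, ∑ j ∈ (L ∪ S).filter (fun j => σ j = i), p j ≤ T + Tε := by
  intro S
  induction S using Finset.induction_on with
  | empty => intro _ _ _; exact ⟨σ₀, by simpa using h₀, by simpa using hL⟩
  | insert a S ha ih =>
    intro hd hS hsum
    rw [Finset.disjoint_insert_right] at hd
    have haLS : a ∉ L ∪ S := by simp [ha, hd.1]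
    rw [Finset.union_insert, Finset.sum_insert haLS] at hsum
    have hpa := hp a
    obtain ⟨σ, h1, h2⟩ := ih hd.2 (fun j hj => hS j (Finset.mem_insert_of_mem hj)) (by linarith)
    have hex : ∃ i ∈ Icc 1 m, ∑ j ∈ (L ∪ S).filter (fun j => σ j = i), p j ≤ T := by
      by_contra hno
      push Not at hno
      have e := Finset.sum_fiberwise_of_maps_to h1 p
      have : ∑ i ∈ Icc 1 m, T ≤ ∑ i ∈ Icc 1 m, ∑ j ∈ (L ∪ S).filter (fun j => σ j = i), p j :=
        Finset.sum_le_sum fun i hi => (hno i hi).le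
      rw [e] at this
      simp at this
      linarith
    obtain ⟨i₀, hi₀, hle⟩ := hex
    rw [Finset.union_insert]
    have hσ : ∀ j ∈ L ∪ S, Function.update σ a i₀ j = σ j := fun j hj =>
      Function.update_of_ne (fun he : j = a => haLS (he ▸ hj)) _ _
    refine ⟨Function.update σ a i₀, ?_, ?_⟩
    · intro j hj
      rcases Finset.mem_insert.1 hj with rfl | hj
      · simpa using hi₀
      · rw [hσ j hj]; exact h1 j hj
    · intro i hi
      have hf : (L ∪ S).filter (fun j => Function.update σ a i₀ j = i)
          = (L ∪ S).filter (fun j => σ j = i) :=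
        Finset.filter_congr fun j hj => by rw [hσ j hj]
      rw [Finset.filter_insert, hf]
      by_cases he : i₀ = i
      · subst he
        rw [if_pos (by simp), Finset.sum_insert (fun hm => haLS (Finset.mem_filter.1 hm).1)]
        linarith [hS a (Finset.mem_insert_self _ _)]
      · rw [if_neg (by simpa using he)]
        exact h2 i hi

lemma sort_exists (m : ℕ) (u : ℕ → ℤ) : ∃ π : ℕ → ℕ,
    (∀ i ∈ Icc 1 m, π i ∈ Icc 1 m) ∧ (∀ y ∈ Icc 1 m, ∃ i ∈ Icc 1 m, π i = y) ∧
    (∀ i ∈ Icc 1 m, ∀ i' ∈ Icc 1 m, π i = π i' → i = i') ∧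
    ∀ i ∈ Icc 1 (m - 1), u (π (i + 1)) ≤ u (π i) := by
  let f : Fin m → ℤ := fun x => -u (x + 1)
  let τ := Tuple.sort f
  have hmono : Monotone (f ∘ τ) := Tuple.monotone_sort f
  let π : ℕ → ℕ := fun i => if h : i - 1 < m then (τ ⟨i - 1, h⟩ : ℕ) + 1 else 0
  have hπ : ∀ (x : Fin m), π (x + 1) = τ x + 1 := by
    intro x
    simp only [π]
    rw [dif_pos (by simp)]
    simp
  have hx : ∀ i ∈ Icc 1 m, ∃ x : Fin m, i = x + 1 := by
    intro i hi
    obtain ⟨h1, h2⟩ := Finset.mem_Icc.1 hi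
    exact ⟨⟨i - 1, by omega⟩, by simp; omega⟩
  have hx' : ∀ x : Fin m, (x : ℕ) + 1 ∈ Icc 1 m := fun x =>
    Finset.mem_Icc.2 ⟨by omega, by have := x.2; omega⟩
  refine ⟨π, ?_, ?_, ?_, ?_⟩
  · intro i hi
    obtain ⟨x, rfl⟩ := hx i hi
    rw [hπ]; exact hx' _
  · intro y hy
    obtain ⟨x, rfl⟩ := hx y hy
    refine ⟨(τ.symm x : ℕ) + 1, hx' _, ?_⟩
    rw [hπ]; simp
  · intro i hi i' hi' he
    obtain ⟨x, rfl⟩ := hx i hi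
    obtain ⟨x', rfl⟩ := hx i' hi'
    rw [hπ, hπ] at he
    have : τ x = τ x' := Fin.ext (by omega)
    rw [τ.injective this]
  · intro i hi
    obtain ⟨h1, h2⟩ := Finset.mem_Icc.1 hi
    have e1 := hπ ⟨i - 1, by omega⟩
    have e2 := hπ ⟨i, by omega⟩
    have h3 := hmono (show (⟨i - 1, by omega⟩ : Fin m) ≤ ⟨i, by omega⟩ from
      Fin.mk_le_mk.2 (by omega))
    simp only [f, Function.comp] at h3
    rw [← e1, ← e2] at h3
    simp only at h3
    rw [show i - 1 + 1 = i by omega] at h3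
    linarith

theorem exists_long {ι : Type*} [Fintype ι] {m r k : ℕ} {p : ι → ℝ} {T w : ℝ}
    {E : Finset (ℕ × ι) → ℝ} {s B M : ℕ} {cl : ℕ → Finset ι}
    (h : SAD m r k p (clb s B cl) T E) (h1 : E ∅ = 1)
    (hB : 2 * M + 1 ≤ B) (hM : ∀ q ∈ Icc 1 s, (cl q).card ≤ M)
    (hr : 2 * k * (k + 1) ^ s + 2 * k + 3 ≤ r)
    (TJ : Finset ι) (hTJ : ∀ j ∈ TJ, p j = T ∧ clb s B cl j = 0) (hw : 0 < w)
    (lo : ℕ → ℝ) (hlo : ∀ q ∈ Icc 1 s, ∀ j ∈ cl q, lo q ≤ p j ∧ p j ≤ lo q + w)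
    (hdisj : ∀ q ∈ Icc 1 s, ∀ q' ∈ Icc 1 s, q ≠ q' → Disjoint (cl q) (cl q'))
    (L : Finset ι) (hL : ∀ j ∈ L, j ∈ TJ ∨ ∃ q ∈ Icc 1 s, j ∈ cl q) :
    ∃ σ : ι → ℕ, (∀ j ∈ L, σ j ∈ Icc 1 m) ∧
      ∀ i ∈ Icc 1 m, ∑ j ∈ L.filter (fun j => σ j = i), p j ≤ T + k * w := by
  obtain ⟨D, hD, hDc, Z, hZm, hZ0, hZc⟩ := h.exists_configs h1 hB hM hr TJ hTJ
  have hσq : ∀ q, ∃ σ : ι → ℕ, q ∈ Icc 1 s → (∀ j ∈ cl q, σ j ∈ Icc 1 m) ∧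
      ∀ i ∈ Icc 1 m, ((cl q).filter fun j => σ j = i).card = ((D i).filter (· ∈ cl q)).card := by
    intro q
    by_cases hq : q ∈ Icc 1 s
    · obtain ⟨σ, hσ⟩ := fiber_assign (Icc 1 m) _ (cl q) (hDc q hq)
      exact ⟨σ, fun _ => hσ⟩
    · exact ⟨fun _ => 0, fun hh => absurd hh hq⟩
  choose σq hσq using hσq
  obtain ⟨τ, hτ1, hτ2⟩ := fiber_assign Z (fun _ => 1) TJ (by simpa using hZc)
  let σ : ι → ℕ := fun j => if hj : ∃ q, q ∈ Icc 1 s ∧ j ∈ cl q then σq hj.choose j else τ j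
  have hσ : ∀ j ∈ L, (j ∈ TJ ∧ σ j = τ j) ∨ ∃ q ∈ Icc 1 s, j ∈ cl q ∧ σ j = σq q j := by
    intro j hj
    by_cases hex : ∃ q, q ∈ Icc 1 s ∧ j ∈ cl q
    · right
      exact ⟨hex.choose, hex.choose_spec.1, hex.choose_spec.2, by simp only [σ]; rw [dif_pos hex]⟩
    · left
      exact ⟨(hL j hj).resolve_right hex, by simp only [σ]; rw [dif_neg hex]⟩
  have hk : 0 ≤ (k : ℝ) * w := by positivity
  refine ⟨σ, ?_, ?_⟩
  · intro j hj
    rcases hσ j hj with ⟨hT, he⟩ | ⟨q, hq, hjq, he⟩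
    · rw [he]; exact hZm (hτ1 j hT)
    · rw [he]; exact (hσq q hq).1 j hjq
  · intro i hi
    by_cases hiZ : i ∈ Z
    · have hsub : L.filter (fun j => σ j = i) ⊆ TJ.filter (fun j => τ j = i) := by
        intro j hj
        obtain ⟨hjL, hji⟩ := Finset.mem_filter.1 hj
        rcases hσ j hjL with ⟨hT, he⟩ | ⟨q, hq, hjq, he⟩
        · exact Finset.mem_filter.2 ⟨hT, he ▸ hji⟩
        · exfalso
          have h0 := (hσq q hq).2 i hi
          rw [hZ0 i hiZ q hq, Finset.card_eq_zero] at h0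
          have : j ∈ (cl q).filter fun j => σq q j = i :=
            Finset.mem_filter.2 ⟨hjq, by rw [← he]; exact hji⟩
          rw [h0] at this
          simp at this
      calc _ ≤ ∑ j ∈ TJ.filter (fun j => τ j = i), p j :=
            Finset.sum_le_sum_of_subset_of_nonneg hsub fun j _ _ => (h.hp j).le
        _ = ∑ j ∈ TJ.filter (fun j => τ j = i), T :=
            Finset.sum_congr rfl fun j hj => (hTJ j (Finset.mem_filter.1 hj).1).1
        _ = T := by rw [Finset.sum_const, hτ2 i hiZ, one_smul]
        _ ≤ _ := by linarith
    · have hsub : L.filter (fun j => σ j = i) ⊆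
          (Icc 1 s).biUnion fun q => (cl q).filter fun j => σq q j = i := by
        intro j hj
        obtain ⟨hjL, hji⟩ := Finset.mem_filter.1 hj
        rcases hσ j hjL with ⟨hT, he⟩ | ⟨q, hq, hjq, he⟩
        · exact absurd (hji ▸ he ▸ hτ1 j hT) hiZ
        · exact Finset.mem_biUnion.2 ⟨q, hq, Finset.mem_filter.2 ⟨hjq, by rw [← he]; exact hji⟩⟩
      have hd1 : (↑(Icc 1 s) : Set ℕ).PairwiseDisjoint
          (fun q => (cl q).filter fun j => σq q j = i) := by
        intro q hq q' hq' hne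
        exact (hdisj q hq q' hq' hne).mono (Finset.filter_subset _ _) (Finset.filter_subset _ _)
      have hd2 : (↑(Icc 1 s) : Set ℕ).PairwiseDisjoint
          (fun q => (D i).filter (· ∈ cl q)) := by
        intro q hq q' hq' hne
        exact (hdisj q hq q' hq' hne).mono (fun j hj => (Finset.mem_filter.1 hj).2)
          (fun j hj => (Finset.mem_filter.1 hj).2)
      calc _ ≤ ∑ j ∈ (Icc 1 s).biUnion fun q => (cl q).filter fun j => σq q j = i, p j :=
            Finset.sum_le_sum_of_subset_of_nonneg hsub fun j _ _ => (h.hp j).le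
        _ = ∑ q ∈ Icc 1 s, ∑ j ∈ (cl q).filter fun j => σq q j = i, p j :=
            Finset.sum_biUnion hd1
        _ ≤ ∑ q ∈ Icc 1 s, ∑ j ∈ (D i).filter (· ∈ cl q), (p j + w) := by
            refine Finset.sum_le_sum fun q hq => ?_
            calc _ ≤ ∑ j ∈ (cl q).filter fun j => σq q j = i, (lo q + w) :=
                  Finset.sum_le_sum fun j hj => (hlo q hq j (Finset.mem_filter.1 hj).1).2
              _ = ∑ j ∈ (D i).filter (· ∈ cl q), (lo q + w) := by
                  rw [Finset.sum_const, Finset.sum_const, (hσq q hq).2 i hi]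
              _ ≤ _ := Finset.sum_le_sum fun j hj => by
                  linarith [(hlo q hq j (Finset.mem_filter.1 hj).2).1]
        _ = ∑ j ∈ (Icc 1 s).biUnion fun q => (D i).filter (· ∈ cl q), (p j + w) :=
            (Finset.sum_biUnion hd2).symm
        _ ≤ ∑ j ∈ D i, (p j + w) := by
            refine Finset.sum_le_sum_of_subset_of_nonneg ?_ fun j _ _ =>
              (add_pos (h.hp j) hw).le
            intro j hj
            obtain ⟨q, _, hq⟩ := Finset.mem_biUnion.1 hj
            exact (Finset.mem_filter.1 hq).1
        _ ≤ T + k * w := by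
            rw [Finset.sum_add_distrib, Finset.sum_const, nsmul_eq_mul]
            have : ((D i).card : ℝ) ≤ k := by exact_mod_cast (hD i hi).1
            exact add_le_add (hD i hi).2 (mul_le_mul_of_nonneg_right this hw.le)

/-! Algebra -/

def SAF {E : Type*} (PE : CubeQuot E →ₗ[ℝ] ℝ) : MvPolynomial E ℝ →ₗ[ℝ] ℝ :=
  PE ∘ₗ (Ideal.Quotient.mkₐ ℝ (cubeIdeal E)).toLinearMap

lemma SAF_apply {E : Type*} (PE : CubeQuot E →ₗ[ℝ] ℝ) (f : MvPolynomial E ℝ) :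
    SAF PE f = PE (mkC f) := rfl

lemma mkC_insert {E : Type*} [DecidableEq E] (A : Finset E) (e : E) :
    mkC (phiSR A ∅ * X e) = mkC (phiSR (insert e A) ∅) := by
  by_cases he : e ∈ A
  · rw [Finset.insert_eq_of_mem he]
    simp only [phiSR, Finset.prod_empty, mul_one]
    rw [← Finset.mul_prod_erase A _ he]
    refine (Ideal.Quotient.eq).2 ?_
    have : X e * (∏ x ∈ A.erase e, X x) * X e - X e * ∏ x ∈ A.erase e, X x
        = (∏ x ∈ A.erase e, X x) * ((X e : MvPolynomial E ℝ) ^ 2 - X e) := by ring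
    rw [this]
    exact Ideal.mul_mem_left _ _ (Ideal.subset_span ⟨e, rfl⟩)
  · simp only [phiSR, Finset.prod_empty, mul_one]
    rw [Finset.prod_insert he, mul_comm]

lemma SAF_insert {E : Type*} [DecidableEq E] (PE : CubeQuot E →ₗ[ℝ] ℝ) (A : Finset E) (e : E) :
    SAF PE (phiSR A ∅ * X e) = SAF PE (phiSR (insert e A) ∅) := by
  rw [SAF_apply, mkC_insert, ← SAF_apply]

lemma SAF_C {E : Type*} (PE : CubeQuot E →ₗ[ℝ] ℝ) (f g : MvPolynomial E ℝ) (a : ℝ) :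
    SAF PE (f * (C a * g)) = a * SAF PE (f * g) := by
  rw [show f * (C a * g) = a • (f * g) by rw [MvPolynomial.smul_eq_C_mul]; ring, map_smul,
    smul_eq_mul]

lemma qdeg_le {E : Type*} (A : Finset E) (g : MvPolynomial E ℝ) (hg : g.totalDegree ≤ 1) :
    qdeg (mkC (phiSR A ∅ * g)) ≤ A.card + 1 := by
  have h0 : qdeg (mkC (phiSR A ∅ * g)) ≤ (phiSR A ∅ * g).totalDegree :=
    Nat.sInf_le ⟨_, rfl, rfl⟩
  refine h0.trans ((totalDegree_mul _ _).trans (Nat.add_le_add ?_ hg))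
  simp only [phiSR, Finset.prod_empty, mul_one]
  refine (totalDegree_finsetProd _ _).trans ?_
  simp

lemma deg_X_le {E : Type*} (e : E) : (X e : MvPolynomial E ℝ).totalDegree ≤ 1 := by simp

lemma deg_CX_le {E : Type*} (a : ℝ) (f : MvPolynomial E ℝ) (hf : f.totalDegree ≤ 1) :
    (C a * f).totalDegree ≤ 1 := by
  refine (totalDegree_mul _ _).trans ?_
  simpa using hf

lemma deg_sub_le {E : Type*} (f g : MvPolynomial E ℝ) (hf : f.totalDegree ≤ 1)
    (hg : g.totalDegree ≤ 1) : (f - g).totalDegree ≤ 1 :=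
  (totalDegree_sub _ _).trans (max_le hf hg)

lemma deg_sum_le {E κ : Type*} (S : Finset κ) (f : κ → MvPolynomial E ℝ)
    (hf : ∀ x ∈ S, (f x).totalDegree ≤ 1) : (∑ x ∈ S, f x).totalDegree ≤ 1 :=
  totalDegree_finsetSum_le hf

lemma mk_SAD {ι : Type*} [Fintype ι] {m s k r B : ℕ} {ε T : ℝ} {p : ι → ℝ}
    (hp : ∀ j, 0 < p j) (hT : 0 < T)
    (hlong : ∀ j, 0 < clb s B (Jq p ε T) j → T ≤ k * p j)
    (PE : CubeQuot (ℕ × ι) →ₗ[ℝ] ℝ)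
    (hPE : IsSAPseudo (assignIneqs m s p ε T B) (assignEqs m ι) r PE) :
    SAD m r k p (clb s B (Jq p ε T)) T (fun A => SAF PE (phiSR A ∅)) := by
  obtain ⟨-, hnn, hG, hH⟩ := hPE
  refine ⟨hT, hp, ?_, hlong, ?_, ?_, ?_, ?_, ?_⟩
  · intro j
    unfold clb
    exact Finset.sum_nonneg fun q _ => by split_ifs <;> positivity
  · intro A hA
    exact hnn A ∅ (Finset.disjoint_empty_right _) (by simpa using hA)
  · intro A e hA
    by_cases he : e ∈ A
    · rw [Finset.insert_eq_of_mem he]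
    · have h1 := hnn A {e} (Finset.disjoint_singleton_right.2 he) (by simpa using hA)
      rw [← SAF_apply, show phiSR A {e} = phiSR A ∅ - phiSR A ∅ * X e by
        simp [phiSR]; ring, map_sub, SAF_insert] at h1
      linarith
  · intro A j hA
    have h1 := hH _ ⟨j, rfl⟩ A ∅ (Finset.disjoint_empty_right _) ((qdeg_le _ _
      (deg_sub_le _ _ (deg_sum_le _ _ fun i _ => deg_X_le _) (by simp))).trans hA)
    rw [← SAF_apply, mul_sub, mul_one, map_sub, Finset.mul_sum, map_sum,
      Finset.sum_congr rfl (fun i _ => SAF_insert PE A (i, j))] at h1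
    linarith
  · intro A hA i hi
    have h1 := hG _ (Or.inl (Or.inl ⟨i, hi, rfl⟩)) A ∅ (Finset.disjoint_empty_right _)
      ((qdeg_le _ _ (deg_sub_le _ _ (by simp)
        (deg_sum_le _ _ fun i _ => deg_CX_le _ _ (deg_X_le _)))).trans hA)
    have h2 := SAF_C PE (phiSR A ∅) 1 T
    rw [mul_one, mul_one] at h2
    rw [← SAF_apply, mul_sub, map_sub, h2, Finset.mul_sum, map_sum,
      Finset.sum_congr rfl (fun j _ => (SAF_C PE (phiSR A ∅) (X (i, j)) (p j)).trans
        (by rw [SAF_insert]))] at h1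
    linarith
  · intro A hA i hi
    have h1 := hG _ (Or.inl (Or.inr ⟨i, hi, rfl⟩)) A ∅ (Finset.disjoint_empty_right _)
      ((qdeg_le _ _ (deg_sum_le _ _ fun q _ => deg_CX_le _ _ (deg_sum_le _ _ fun j _ =>
        deg_sub_le _ _ (deg_X_le _) (deg_X_le _)))).trans hA)
    have h2 : ∀ q ∈ Icc 1 s, SAF PE (phiSR A ∅ * (C ((B : ℝ) ^ (s - q)) *
          ∑ j ∈ Jq p ε T q, ((X (i, j) : MvPolynomial (ℕ × ι) ℝ) - X (i + 1, j))))
        = (B : ℝ) ^ (s - q) * ∑ j ∈ Jq p ε T q, SAF PE (phiSR (insert (i, j) A) ∅)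
          - (B : ℝ) ^ (s - q) * ∑ j ∈ Jq p ε T q, SAF PE (phiSR (insert (i + 1, j) A) ∅) := by
      intro q _
      rw [SAF_C, Finset.mul_sum, map_sum, ← mul_sub, ← Finset.sum_sub_distrib]
      congr 1
      refine Finset.sum_congr rfl fun j _ => ?_
      rw [mul_sub, map_sub, SAF_insert, SAF_insert]
    rw [← SAF_apply, Finset.mul_sum, map_sum, Finset.sum_congr rfl h2,
      Finset.sum_sub_distrib] at h1
    have e1 := SAD.bV_eq (E := fun A => SAF PE (phiSR A ∅)) (s := s) (B := B) (cl := Jq p ε T) i A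
    have e2 := SAD.bV_eq (E := fun A => SAF PE (phiSR A ∅)) (s := s) (B := B) (cl := Jq p ε T)
      (i + 1) A
    unfold bV at e1 e2
    rw [e1, e2]
    linarith

theorem exists_makespan {ι : Type*} [Fintype ι]
    (m s : ℕ) (ε T : ℝ) (p : ι → ℝ)
    (hp : ∀ j, 0 < p j) (hT : 0 < T)
    (hε0 : 0 < ε) (hε1 : ε < 1) (hεint : ∃ t : ℤ, ε * (t : ℝ) = 1)
    (hs : (s : ℝ) = (1 - ε) / ε ^ 2)
    (B : ℕ) (hB : B = 1 + 2 * s * ((Finset.Icc 1 s).sup fun q => (Jq p ε T q).card))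
    (r : ℕ) (hr : 2 / ε ^ 2 * ∑ q ∈ Finset.range (s + 1), (1 / ε + 1) ^ q ≤ (r : ℝ))
    (hpe : ∃ PE : CubeQuot (ℕ × ι) →ₗ[ℝ] ℝ,
      IsSAPseudo (assignIneqs m s p ε T B) (assignEqs m ι) r PE) :
    ∃ σ : ι → ℕ, (∀ j, σ j ∈ Finset.Icc 1 m) ∧
      ∀ i ∈ Finset.Icc 1 m,
        ∑ j ∈ Finset.univ.filter (fun j => σ j = i), p j ≤ (1 + ε) * T := by
  obtain ⟨PE, hPE⟩ := hpe
  obtain ⟨k, hk⟩ : ∃ k : ℕ, ε * (k : ℝ) = 1 := by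
    obtain ⟨t, ht⟩ := hεint
    have ht0 : (0 : ℝ) < t := by
      by_contra hn
      push Not at hn
      nlinarith
    have ht0' : 0 ≤ t := by exact_mod_cast ht0.le
    obtain ⟨k, rfl⟩ := Int.eq_ofNat_of_zero_le ht0'
    exact ⟨k, by simpa using ht⟩
  have hεk : 1 / ε = k := by field_simp; linarith
  have hk2 : 2 ≤ k := by
    by_contra hn
    have : (k : ℝ) ≤ 1 := by exact_mod_cast (by omega : k ≤ 1)
    nlinarith
  have hsk : s + k = k * k := by
    have : (s : ℝ) + k = k * k := by
      rw [hs, ← hεk]; field_simp; ring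
    exact_mod_cast this
  have hs1 : 1 ≤ s := by nlinarith
  have hskr : (s : ℝ) + k = k * k := by exact_mod_cast hsk
  set w : ℝ := ε ^ 2 * T with hw
  have hw0 : 0 < w := by positivity
  have hkw : (k : ℝ) * w = ε * T := by
    rw [hw]; linear_combination ε * T * hk
  have hkkw : (k : ℝ) * k * w = T := by
    rw [hw]; linear_combination (ε * k + 1) * T * hk
  have hr' : 2 * k * (k + 1) ^ s + 2 * k + 3 ≤ r := by
    have h1 : 2 * (k * k) * ∑ q ∈ Finset.range (s + 1), (k + 1) ^ q ≤ r := by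
      have e : 2 / ε ^ 2 = 2 * ((k : ℝ) * k) := by rw [← hεk]; field_simp
      rw [e, hεk] at hr
      exact_mod_cast hr
    have h2 : (k + 1) ^ s + 1 ≤ ∑ q ∈ Finset.range (s + 1), (k + 1) ^ q := by
      rw [Finset.sum_range_succ, add_comm]
      refine Nat.add_le_add_right ?_ _
      have := Finset.single_le_sum (f := fun q => (k + 1) ^ q) (fun q _ => Nat.zero_le _)
        (Finset.mem_range.2 (show 0 < s by omega))
      simpa using this
    have h3 : 0 < (k + 1) ^ s := by positivity
    calc 2 * k * (k + 1) ^ s + 2 * k + 3 ≤ 2 * (k * k) * ((k + 1) ^ s + 1) := by nlinarith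
      _ ≤ _ := (Nat.mul_le_mul_left _ h2).trans h1
  have hmem : ∀ q j, j ∈ Jq p ε T q ↔
      ((k : ℝ) + q - 1) * w ≤ p j ∧ p j < ((k : ℝ) + q) * w := by
    intro q j
    simp only [Jq, Finset.mem_filter, Finset.mem_univ, true_and, hεk, hw, mul_assoc]
  have hclass : ∀ j, 0 < clb s B (Jq p ε T) j → ∃ q ∈ Icc 1 s, j ∈ Jq p ε T q := by
    intro j hj
    by_contra hno
    push Not at hno
    have : clb s B (Jq p ε T) j = 0 := Finset.sum_eq_zero fun q hq => if_neg (hno q hq)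
    linarith
  have hlong : ∀ j, 0 < clb s B (Jq p ε T) j → T ≤ k * p j := by
    intro j hj
    obtain ⟨q, hq, hjq⟩ := hclass j hj
    have h1 := ((hmem q j).1 hjq).1
    have h2 : (1 : ℝ) ≤ q := by exact_mod_cast (Finset.mem_Icc.1 hq).1
    have h3 : (k : ℝ) * w ≤ p j := by nlinarith
    calc T = k * (k * w) := by rw [← hkkw]; ring
      _ ≤ _ := mul_le_mul_of_nonneg_left h3 (Nat.cast_nonneg _)
  have h := mk_SAD (k := k) hp hT hlong PE hPE
  set E : Finset (ℕ × ι) → ℝ := fun A => SAF PE (phiSR A ∅) with hE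
  have hE1 : E ∅ = 1 := by
    have := hPE.1
    simp only [hE, phiSR, Finset.prod_empty, mul_one, SAF_apply, map_one]
    exact this
  have hpT : ∀ j, p j ≤ T := by
    intro j
    by_contra hlt
    have h1 := h.eqn ∅ j (by simp; omega)
    rw [hE1, Finset.sum_eq_zero] at h1
    · norm_num at h1
    · intro i hi
      rcases (h.nonneg (insert (i, j) ∅) (by simp; omega)).eq_or_lt with h0 | hpos
      · exact h0.symm
      · have := h.load_pos (A := insert (i, j) ∅) (by simp; omega) hpos hi {j} (by simp)
        simp at this
        exact absurd this hlt
  have htot : ∑ j, p j ≤ m * T := by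
    have h1 : ∑ i ∈ Icc 1 m, ∑ j, p j * E (insert (i, j) ∅) ≤ ∑ i ∈ Icc 1 m, T := by
      refine Finset.sum_le_sum fun i hi => ?_
      have := h.load ∅ (by simp; omega) i hi
      rwa [hE1, mul_one] at this
    rw [Finset.sum_comm] at h1
    simp_rw [← Finset.mul_sum] at h1
    rw [Finset.sum_congr rfl (fun j _ => by rw [h.eqn ∅ j (by simp; omega), hE1, mul_one])] at h1
    simpa using h1
  have hB' : 2 * ((Icc 1 s).sup fun q => (Jq p ε T q).card) + 1 ≤ B := by
    rw [hB]; nlinarith [Nat.zero_le ((Icc 1 s).sup fun q => (Jq p ε T q).card)]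
  have hdisj' : ∀ q q' : ℕ, q < q' → Disjoint (Jq p ε T q) (Jq p ε T q') := by
    intro q q' hlt
    rw [Finset.disjoint_left]
    intro j hj hj'
    have h1 := ((hmem q j).1 hj).2
    have h2 := ((hmem q' j).1 hj').1
    have h3 : (q : ℝ) + 1 ≤ q' := by exact_mod_cast hlt
    nlinarith
  let L : Finset ι := univ.filter fun j => ε * T ≤ p j
  let TJ : Finset ι := univ.filter fun j => p j = T
  obtain ⟨σ₀, h01, h02⟩ := exists_long h hE1 hB'
    (fun q hq => Finset.le_sup (f := fun q => (Jq p ε T q).card) hq) hr' TJ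
    (by
      intro j hj
      have hjT : p j = T := by simpa [TJ] using hj
      refine ⟨hjT, Finset.sum_eq_zero fun q hq => if_neg fun hjq => ?_⟩
      have h1 := ((hmem q j).1 hjq).2
      have h2 : (q : ℝ) ≤ s := by exact_mod_cast (Finset.mem_Icc.1 hq).2
      have h3 : ((k : ℝ) + q) * w ≤ k * k * w :=
        mul_le_mul_of_nonneg_right (by linarith) hw0.le
      linarith)
    hw0 (fun q => ((k : ℝ) + q - 1) * w)
    (by
      intro q _ j hj
      have h1 := (hmem q j).1 hj
      refine ⟨h1.1, ?_⟩
      linarith [h1.2])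
    (by
      intro q _ q' _ hne
      rcases lt_or_gt_of_ne hne with hlt | hlt
      · exact hdisj' q q' hlt
      · exact (hdisj' q' q hlt).symm)
    L
    (by
      intro j hj
      have hjL : ε * T ≤ p j := by simpa [L] using hj
      rcases (hpT j).eq_or_lt with he | hlt
      · left; simp [TJ, he]
      · right
        have hpw : 0 ≤ p j / w := (div_pos (hp j) hw0).le
        have hf1 := Nat.floor_le hpw
        have hf2 := Nat.lt_floor_add_one (p j / w)
        have hkf : k ≤ ⌊p j / w⌋₊ := by
          refine Nat.le_floor ?_
          rw [le_div_iff₀ hw0, hkw]; exact hjL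
        have hfk : ⌊p j / w⌋₊ < k * k := by
          rw [Nat.floor_lt hpw, div_lt_iff₀ hw0]
          push_cast
          linarith
        rw [le_div_iff₀ hw0] at hf1
        rw [div_lt_iff₀ hw0] at hf2
        refine ⟨⌊p j / w⌋₊ - k + 1, Finset.mem_Icc.2 ⟨by omega, by omega⟩, (hmem _ _).2 ?_⟩
        push_cast [Nat.cast_sub hkf]
        constructor
        · linarith
        · linarith)
  obtain ⟨σ, h1, h2⟩ := greedy m p hp T (k * w) L σ₀ h01 h02 (univ.filter fun j => ¬ ε * T ≤ p j)
    (Finset.disjoint_filter_filter_not _ _ _)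
    (by
      intro j hj
      rw [hkw]
      exact (not_le.1 (Finset.mem_filter.1 hj).2).le)
    (by rw [Finset.filter_union_filter_not_eq]; exact htot)
  rw [Finset.filter_union_filter_not_eq] at h1 h2
  refine ⟨σ, fun j => h1 j (Finset.mem_univ _), fun i hi => ?_⟩
  have := h2 i hi
  rw [hkw] at this
  linarith

/-- If `assign(B,T)` admits a degree-`r` SA pseudoexpectation with
`r ≥ (2/ε²)·Σ_{q=0}^{s}(1/ε+1)^q`, then `assign(B,(1+ε)T)` has an integral solution;
in particular there is an assignment of makespan at most `(1+ε)T`. -/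
theorem sa_pseudoexpectation_gives_integral_solution {ι : Type*} [Fintype ι]
    (m s : ℕ) (ε T : ℝ) (p : ι → ℝ)
    (hp : ∀ j, 0 < p j) (hT : 0 < T)
    (hε0 : 0 < ε) (hε1 : ε < 1) (hεint : ∃ t : ℤ, ε * (t : ℝ) = 1)
    (hs : (s : ℝ) = (1 - ε) / ε ^ 2)
    (B : ℕ) (hB : B = 1 + 2 * s * ((Finset.Icc 1 s).sup fun q => (Jq p ε T q).card))
    (r : ℕ) (hr : 2 / ε ^ 2 * ∑ q ∈ Finset.range (s + 1), (1 / ε + 1) ^ q ≤ (r : ℝ))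
    (hpe : ∃ PE : CubeQuot (ℕ × ι) →ₗ[ℝ] ℝ,
      IsSAPseudo (assignIneqs m s p ε T B) (assignEqs m ι) r PE) :
    (∃ x : ℕ → ι → ℕ, (∀ i j, x i j ≤ 1) ∧
      (∀ j : ι, ∑ i ∈ Finset.Icc 1 m, x i j = 1) ∧
      (∀ i ∈ Finset.Icc 1 m, ∑ j : ι, (x i j : ℝ) * p j ≤ (1 + ε) * T) ∧
      (∀ i ∈ Finset.Icc 1 (m - 1),
        0 ≤ ∑ q ∈ Finset.Icc 1 s,
              (B : ℤ) ^ (s - q) * ∑ j ∈ Jq p ε T q, ((x i j : ℤ) - (x (i + 1) j : ℤ)))) ∧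
    ∃ σ : ι → ℕ, (∀ j, σ j ∈ Finset.Icc 1 m) ∧
      ∀ i ∈ Finset.Icc 1 m,
        ∑ j ∈ Finset.univ.filter (fun j => σ j = i), p j ≤ (1 + ε) * T := by
  obtain ⟨σ, hσ, hload⟩ := exists_makespan m s ε T p hp hT hε0 hε1 hεint hs B hB r hr hpe
  refine ⟨?_, σ, hσ, hload⟩
  obtain ⟨π, h1, h2, h3, h4⟩ := sort_exists m (fun i => ∑ q ∈ Finset.Icc 1 s,
    (B : ℤ) ^ (s - q) * ∑ j ∈ Jq p ε T q, ((if σ j = i then 1 else 0 : ℕ) : ℤ))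
  refine ⟨fun i j => if σ j = π i then 1 else 0, ?_, ?_, ?_, ?_⟩
  · intro i j
    dsimp only
    split_ifs <;> simp
  · intro j
    obtain ⟨i, hi, hiσ⟩ := h2 _ (hσ j)
    rw [Finset.sum_eq_single_of_mem i hi]
    · exact if_pos hiσ.symm
    intro i' hi' hne
    exact if_neg fun he => hne (h3 i' hi' i hi (by rw [← he, hiσ]))
  · intro i hi
    have := hload (π i) (h1 i hi)
    rw [Finset.sum_filter] at this
    refine le_trans (le_of_eq (Finset.sum_congr rfl fun j _ => ?_)) this
    by_cases hj : σ j = π i <;> simp [hj]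
  · intro i hi
    have := h4 i hi
    simp only [Finset.sum_sub_distrib, mul_sub]
    linarith
end
end
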